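/- A C*-algebra A is a Rickart C*-algebra if and only if A is unital and, for every x ∈ A and every inner ideal J ⊆ A which is orthogonal to the inner ideal A(x) generated by x, there exists a partial isometry e ∈ A such that A(x) ⊆ A₂(e) and J ⊆ A₀(e). -/

import Mathlib

/-- A projection in a C*-algebra: a self-adjoint idempotent. -/
def IsProjection {A : Type*} [Mul A] [Star A] (p : A) : Prop :=
  star p = p ∧ p * p = p

/-- A partial isometry: an element `e` such that `e * e*` is a projection. -/
def IsPartialIsometry {A : Type*} [Mul A] [Star A] (e : A) : Prop :=
  IsProjection (e * star e)

/-- A C*-algebra is Rickart if the right annihilator of every singleton is of the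
form `p A` for a projection `p`. -/
def IsRickart (A : Type*) [NonUnitalCStarAlgebra A] : Prop :=
  ∀ x : A, ∃ p : A, IsProjection p ∧
    {y : A | x * y = 0} = {z : A | ∃ a : A, z = p * a}

/-- The Peirce-2 subspace associated with a partial isometry `e`. -/
def Peirce2 {A : Type*} [Mul A] [Star A] (e : A) : Set A :=
  {z : A | e * star e * z * (star e * e) = z}

/-- The Peirce-0 subspace associated with a partial isometry `e`. -/
def Peirce0 {A : Type*} [Mul A] [Star A] [Zero A] (e : A) : Set A :=
  {z : A | e * star e * z = 0 ∧ z * (star e * e) = 0}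

/-- Orthogonality of elements in a C*-algebra: `a ⊥ b` iff `a b* = 0` and `b* a = 0`. -/
def Orthog {A : Type*} [Mul A] [Star A] [Zero A] (a b : A) : Prop :=
  a * star b = 0 ∧ star b * a = 0

/-- A linear subspace `J` is an inner ideal if `x a y ∈ J` for all `x, y ∈ J`, `a ∈ A`. -/
def IsInnerIdeal {A : Type*} [NonUnitalCStarAlgebra A] (J : Submodule ℂ A) : Prop :=
  ∀ x ∈ J, ∀ y ∈ J, ∀ a : A, x * a * y ∈ J

/-- The inner ideal of `A` generated by `x`: the norm closure of `x A x`. -/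
def innerIdealGen {A : Type*} [NonUnitalCStarAlgebra A] (x : A) : Set A :=
  closure {z : A | ∃ a : A, z = x * a * x}

/-- A unital C*-algebra in which the right annihilator of every element is generated by a
projection; the projection `r` below is the complement of the annihilating one. -/
class RickartCStar (A : Type*) [CStarAlgebra A] : Prop where
  exists_rightProj : ∀ x : A, ∃ r : A, IsProjection r ∧ ∀ z, x * z = 0 ↔ r * z = 0

theorem mul_mul_of_mul_eq {A : Type*} [Semigroup A] {a b c : A} (h : a * b = c) (z : A) :
    a * (b * z) = c * z := by rw [← mul_assoc, h]

namespace IsProjection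

variable {A : Type*} [CStarAlgebra A] {p q v x y : A}

theorem one_sub (hp : IsProjection p) : IsProjection (1 - p) := by
  refine ⟨by simp [hp.1], ?_⟩
  simp [mul_sub, sub_mul, hp.2]

theorem zero : IsProjection (0 : A) := ⟨by simp, by simp⟩

theorem add (hp : IsProjection p) (hq : IsProjection q) (h : p * q = 0) :
    IsProjection (p + q) := by
  have h' : q * p = 0 := by
    have := congrArg star h
    simpa [hp.1, hq.1] using this
  refine ⟨by simp [hp.1, hq.1], ?_⟩
  simp [mul_add, add_mul, hp.2, hq.2, h, h']

theorem mul_comm_of_eq_left (hp : IsProjection p) (hq : IsProjection q) (h : p * q = p) :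
    q * p = p := by
  have := congrArg star h
  simpa [hp.1, hq.1] using this

theorem mul_comm_of_eq_right (hp : IsProjection p) (hq : IsProjection q) (h : p * q = q) :
    q * p = q := by
  have := congrArg star h
  simpa [hp.1, hq.1] using this

theorem mul_eq_zero_symm (hp : IsProjection p) (hq : IsProjection q) (h : p * q = 0) :
    q * p = 0 := by
  have := congrArg star h
  simpa [hp.1, hq.1] using this

theorem sub (hp : IsProjection p) (hq : IsProjection q) (h : p * q = q) :
    IsProjection (p - q) := by
  have h' := hp.mul_comm_of_eq_right hq h
  refine ⟨by simp [hp.1, hq.1], ?_⟩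
  simp [mul_sub, sub_mul, hp.2, hq.2, h, h']

theorem eq_of_ker (hp : IsProjection p) (hq : IsProjection q)
    (h : ∀ z, p * z = 0 ↔ q * z = 0) : p = q := by
  have h1 : p * (1 - q) = 0 := (h _).2 (by simp [mul_sub, hq.2])
  have h2 : q * (1 - p) = 0 := (h _).1 (by simp [mul_sub, hp.2])
  rw [mul_sub, mul_one, sub_eq_zero] at h1 h2
  have := hp.mul_comm_of_eq_left hq h1.symm
  exact this.symm.trans h2.symm

theorem mul_eq_self (hp : IsProjection p) (h : star v * v = p) : v * p = v := by
  have : star (v * (1 - p)) * (v * (1 - p)) = 0 := by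
    simp [mul_assoc, mul_mul_of_mul_eq h, hp.1, mul_sub, sub_mul, hp.2, h]
  have := (CStarRing.star_mul_self_eq_zero_iff _).1 this
  rw [mul_sub, mul_one, sub_eq_zero] at this
  exact this.symm

theorem mul_star (hp : IsProjection p) (h : star v * v = p) : IsProjection (v * star v) := by
  refine ⟨by simp, ?_⟩
  rw [mul_assoc, mul_mul_of_mul_eq h, ← mul_assoc, hp.mul_eq_self h]

theorem mul_star_mul (hp : IsProjection p) (h : star v * v = p) : v * star v * v = v := by
  rw [mul_assoc, h, hp.mul_eq_self h]

theorem mul_star_self (hp : IsProjection p) (h : star v * v = p) : p * star v = star v := by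
  have := congrArg star (hp.mul_eq_self h)
  simpa [hp.1] using this

end IsProjection

namespace RickartCStar

variable {A : Type*} [CStarAlgebra A]

theorem mul_eq_zero_of_star_mul {h y : A} (H : star h * h * y = 0) : h * y = 0 := by
  have : star (h * y) * (h * y) = 0 := by
    simp only [star_mul]
    rw [mul_assoc, ← mul_assoc (star h), H, mul_zero]
  exact (CStarRing.star_mul_self_eq_zero_iff _).1 this

/-- `p` is equivalent to a subprojection of `q`. -/
def Sub (p q : A) : Prop := ∃ v : A, star v * v = p ∧ q * v = v

/-- `p` is equivalent to a projection orthogonal to it. -/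
def Small (p : A) : Prop := ∃ v : A, star v * v = p ∧ p * v = 0

theorem Sub.trans {p q r : A} (h1 : Sub p q) (h2 : Sub q r) : Sub p r := by
  obtain ⟨v, hv, hv'⟩ := h1
  obtain ⟨w, hw, hw'⟩ := h2
  refine ⟨w * v, ?_, by rw [← mul_assoc, hw']⟩
  simp [mul_assoc, mul_mul_of_mul_eq hw, hv', hv]

theorem Sub.add {p₁ p₂ q₁ q₂ : A} (hq₁ : IsProjection q₁) (hq₂ : IsProjection q₂)
    (hq : q₁ * q₂ = 0) (h1 : Sub p₁ q₁) (h2 : Sub p₂ q₂) : Sub (p₁ + p₂) (q₁ + q₂) := by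
  obtain ⟨v, hv, hv'⟩ := h1
  obtain ⟨w, hw, hw'⟩ := h2
  have hvw : star v * w = 0 := by
    rw [← hv', ← hw']; simp [mul_assoc, hq₁.1, mul_mul_of_mul_eq hq]
  have hwv : star w * v = 0 := by simpa using congrArg star hvw
  have e1 : q₁ * w = 0 := by rw [← hw', mul_mul_of_mul_eq hq, zero_mul]
  have e2 : q₂ * v = 0 := by
    rw [← hv', mul_mul_of_mul_eq (hq₁.mul_eq_zero_symm hq₂ hq), zero_mul]
  exact ⟨v + w, by simp [mul_add, add_mul, hv, hw, hvw, hwv],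
    by simp [mul_add, add_mul, hv', hw', e1, e2]⟩

theorem Sub.of_mul_eq {p q : A} (hp : IsProjection p) (h : q * p = p) : Sub p q :=
  ⟨p, by rw [hp.1, hp.2], h⟩

variable [RickartCStar A]

/-- The right projection of `x`. -/
noncomputable def rp (x : A) : A := (exists_rightProj x).choose

/-- The left projection of `x`. -/
noncomputable def lp (x : A) : A := rp (star x)

theorem rp_proj (x : A) : IsProjection (rp x) := (exists_rightProj x).choose_spec.1

theorem rp_ker (x z : A) : x * z = 0 ↔ rp x * z = 0 := (exists_rightProj x).choose_spec.2 z

theorem mul_rp (x : A) : x * rp x = x := by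
  have : x * (1 - rp x) = 0 := (rp_ker _ _).2 (by simp [mul_sub, (rp_proj x).2])
  rw [mul_sub, mul_one, sub_eq_zero] at this
  exact this.symm

theorem rp_mul_eq {x p : A} (h : x * p = x) : rp x * p = rp x := by
  have : rp x * (1 - p) = 0 := (rp_ker _ _).1 (by simp [mul_sub, h])
  rw [mul_sub, mul_one, sub_eq_zero] at this
  exact this.symm

theorem mul_rp_eq {x p : A} (hp : star p = p) (h : x * p = x) : p * rp x = rp x := by
  have := congrArg star (rp_mul_eq h)
  simpa [hp, (rp_proj x).1] using this

theorem rp_eq_of_ker {x r : A} (hr : IsProjection r) (h : ∀ z, x * z = 0 ↔ r * z = 0) :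
    rp x = r :=
  (rp_proj x).eq_of_ker hr fun z => (rp_ker x z).symm.trans (h z)

theorem rp_congr {x y : A} (h : ∀ z, x * z = 0 ↔ y * z = 0) : rp x = rp y :=
  rp_eq_of_ker (rp_proj y) fun z => (h z).trans (rp_ker y z)

theorem lp_proj (x : A) : IsProjection (lp x) := rp_proj _

theorem lp_ker (x z : A) : z * x = 0 ↔ z * lp x = 0 := by
  have := rp_ker (star x) (star z)
  rw [← star_eq_zero (x := star x * star z), ← star_eq_zero (x := rp _ * star z)] at this
  simpa [lp, (rp_proj (star x)).1] using this

theorem lp_mul (x : A) : lp x * x = x := by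
  have := congrArg star (mul_rp (star x))
  simpa [lp, (rp_proj (star x)).1] using this

theorem mul_lp_eq {x p : A} (hp : star p = p) (h : p * x = x) : p * lp x = lp x :=
  mul_rp_eq hp (by simpa [hp] using congrArg star h)

theorem lp_star (x : A) : lp (star x) = rp x := by simp [lp]

/-- The right projection of `x` is the initial projection of a partial isometry whose range is
dominated by that of `x`. -/
def Good (x : A) : Prop := ∃ w : A, star w * w = rp x ∧ ∀ y, y * x = 0 → y * w = 0

/-- Every element with range in `p` has right projection subequivalent to `p`. -/
def GoodProj (p : A) : Prop := ∀ y : A, p * y = y → Sub (rp y) p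

theorem Good.sub {x p : A} (h : Good x) (hp : p * x = x) : Sub (rp x) p := by
  obtain ⟨w, hw, h⟩ := h
  refine ⟨w, hw, ?_⟩
  have := h (1 - p) (by simp [sub_mul, hp])
  rw [sub_mul, one_mul, sub_eq_zero] at this
  exact this.symm

theorem Good.roomL {v x : A} (h : star v * v * x = x) (hg : Good (v * x)) : Good x := by
  obtain ⟨w, hw, h'⟩ := hg
  have hr : rp (v * x) = rp x := rp_congr fun z => by
    constructor
    · intro hz
      rw [← h, mul_assoc (star v), mul_assoc, hz, mul_zero]
    · intro hz
      rw [mul_assoc, hz, mul_zero]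
  have hvw : v * star v * w = w := by
    have := h' (1 - v * star v) (by rw [sub_mul, one_mul, mul_assoc, ← mul_assoc (star v), h, sub_self])
    rw [sub_mul, one_mul, sub_eq_zero] at this
    exact this.symm
  refine ⟨star v * w, ?_, fun y hy => ?_⟩
  · rw [star_mul, star_star, mul_assoc, ← mul_assoc v, hvw, hw, hr]
  · rw [← mul_assoc]
    exact h' _ (by rw [mul_assoc, ← mul_assoc (star v), h, hy])

theorem Good.roomR {v x : A} (h : star v * v = rp x) (hg : Good (x * star v)) : Good x := by
  obtain ⟨w, hw, h'⟩ := hg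
  have hp := rp_proj x
  have hr : rp (x * star v) = v * star v :=
    rp_eq_of_ker (hp.mul_star h) fun z => by
      constructor
      · intro hz
        rw [mul_assoc, rp_ker, ← mul_assoc, hp.mul_star_self h] at hz
        rw [mul_assoc, hz, mul_zero]
      · intro hz
        have : star v * (v * star v * z) = star v * z := by
          rw [← mul_assoc, ← mul_assoc, h, hp.mul_star_self h]
        rw [hz, mul_zero] at this
        rw [mul_assoc, ← this, mul_zero]
  refine ⟨w * v, ?_, fun y hy => ?_⟩
  · rw [star_mul, mul_assoc, ← mul_assoc (star w), hw, hr, hp.mul_star_mul h, h]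
  · rw [← mul_assoc, h' y (by rw [← mul_assoc, hy, zero_mul]), zero_mul]

theorem norm_proj_le {A : Type*} [CStarAlgebra A] {p : A} (hp : IsProjection p) : ‖p‖ ≤ 1 := by
  have h : ‖p‖ = ‖p‖ * ‖p‖ := by
    have := CStarRing.norm_star_mul_self (x := p)
    rwa [hp.1, hp.2] at this
  nlinarith [norm_nonneg p]

/-- Countable families have a supremum of right projections. -/
theorem exists_sup {ι : Type*} [Countable ι] (y : ι → A) :
    ∃ P : A, IsProjection P ∧ ∀ z, P * z = 0 ↔ ∀ i, y i * z = 0 := by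
  let _ : PartialOrder A := CStarAlgebra.spectralOrder A
  have : StarOrderedRing A := CStarAlgebra.spectralOrderedRing A
  obtain ⟨f, hf⟩ := exists_injective_nat ι
  have hs : Summable fun i => ((1 / 2 : ℝ) ^ f i) • rp (y i) := by
    refine Summable.of_norm_bounded (summable_geometric_two.comp_injective hf) fun i => ?_
    rw [norm_smul, Real.norm_of_nonneg (by positivity)]
    exact mul_le_of_le_one_right (by positivity) (norm_proj_le (rp_proj _))
  refine ⟨rp (∑' i, ((1 / 2 : ℝ) ^ f i) • rp (y i)), rp_proj _, fun z => ?_⟩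
  rw [← rp_ker]
  constructor
  · intro hz i
    have h1 := ((hs.hasSum.mul_right z).mul_left (star z))
    rw [hz, mul_zero] at h1
    have h2 : ∀ i, star z * (((1 / 2 : ℝ) ^ f i) • rp (y i) * z)
        = ((1 / 2 : ℝ) ^ f i) • (star (rp (y i) * z) * (rp (y i) * z)) := fun i => by
      rw [star_mul, (rp_proj (y i)).1, mul_assoc, ← mul_assoc (rp (y i)), (rp_proj (y i)).2,
        smul_mul_assoc, mul_smul_comm]
    have h3 := (hasSum_zero_iff_of_nonneg fun i => by
      rw [h2]
      exact smul_nonneg (by positivity) (star_mul_self_nonneg _)).1 h1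
    have h4 := congrFun h3 i
    simp only [h2, Pi.zero_apply] at h4
    have h5 := (smul_eq_zero.1 h4).resolve_left (by positivity)
    exact (rp_ker _ _).2 ((CStarRing.star_mul_self_eq_zero_iff _).1 h5)
  · intro hz
    rw [← hs.tsum_mul_right]
    simp [(rp_ker _ _).1 (hz _)]

/-- The supremum of a countable family of projections. -/
theorem exists_sup_proj {ι : Type*} [Countable ι] (p : ι → A) (hp : ∀ i, IsProjection (p i)) :
    ∃ P : A, IsProjection P ∧ (∀ i, P * p i = p i) ∧ (∀ i, p i * P = p i) ∧
      (∀ z, (∀ i, p i * z = 0) → P * z = 0) ∧ (∀ z, (∀ i, z * p i = 0) → z * P = 0) := by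
  obtain ⟨P, hP, h⟩ := exists_sup p
  have h1 : ∀ i, p i * P = p i := fun i => by
    have := (h (1 - P)).1 (by simp [mul_sub, hP.2]) i
    rw [mul_sub, mul_one, sub_eq_zero] at this
    exact this.symm
  refine ⟨P, hP, fun i => (hp i).mul_comm_of_eq_left hP (h1 i), h1, fun z hz => (h z).2 hz,
    fun z hz => ?_⟩
  have := (h (star z)).2 fun i => by simpa [(hp i).1] using congrArg star (hz i)
  simpa [hP.1] using congrArg star this

theorem rp_commute {y b : A} (hb : IsSelfAdjoint b) (hyb : Commute y b) : Commute (rp y) b := by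
  have h1 : y * (b * (1 - rp y)) = 0 := by
    rw [← mul_assoc, hyb.eq, mul_assoc, mul_sub, mul_rp]; simp
  have h2 : rp y * b = rp y * b * rp y := by
    have := (rp_ker _ _).1 h1
    rwa [mul_sub, mul_sub, mul_one, sub_eq_zero, ← mul_assoc] at this
  have h3 := congrArg star h2
  simp only [star_mul, (rp_proj y).1, hb.star_eq] at h3
  rw [← mul_assoc, ← h2] at h3
  exact h3.symm

/-- An increasing sequence of spectral projections exhausting the support of `star x * x`, each of
which comes with a partial inverse square root. -/
theorem exists_spectral_filtration (x : A) : ∃ p b : ℕ → A, (∀ n, IsProjection (p n)) ∧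
    (∀ n, p n * p (n + 1) = p n) ∧ (∀ n, IsSelfAdjoint (b n)) ∧
    (∀ m n, Commute (p m) (b n)) ∧ (∀ n, Commute (p n) (star x * x)) ∧
    
    (∀ n, b n * (star x * x) * b n * p n = p n) ∧
    ∀ z, x * z = 0 ↔ ∀ n, p n * z = 0 := by
  set h := star x * x with hh
  have hsa : IsSelfAdjoint h := IsSelfAdjoint.star_mul_self x
  have hpos : ∀ t ∈ spectrum ℝ h, 0 ≤ t := by
    let _ : PartialOrder A := CStarAlgebra.spectralOrder A
    have : StarOrderedRing A := CStarAlgebra.spectralOrderedRing A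
    exact fun t ht => spectrum_nonneg_of_nonneg (star_mul_self_nonneg x) ht
  have hm : ∀ g₁ g₂ g₃ : ℝ → ℝ, Continuous g₁ → Continuous g₂ → (∀ t, g₁ t * g₂ t = g₃ t) →
      cfc g₁ h * cfc g₂ h = cfc g₃ h := fun g₁ g₂ g₃ h1 h2 h3 => by
    rw [← cfc_mul g₁ g₂ h h1.continuousOn h2.continuousOn]
    exact congrArg (cfc · h) (funext h3)
  have hid : cfc (fun t : ℝ => t) h = h := cfc_id' ℝ h
  have hcomm : ∀ g₁ g₂ : ℝ → ℝ, Commute (cfc g₁ h) (cfc g₂ h) := fun g₁ g₂ => cfc_commute_cfc g₁ g₂ h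
  have hsag : ∀ g : ℝ → ℝ, IsSelfAdjoint (cfc g h) := fun g => cfc_predicate g h
  let ε : ℕ → ℝ := fun n => 1 / ((n : ℝ) + 1)
  have hε : ∀ n, 0 < ε n := fun n => by positivity
  have hε' : ∀ n, 0 < ε n - ε (n + 1) := fun n => by
    simp only [ε, sub_pos]
    apply one_div_lt_one_div_of_lt (by positivity); push_cast; linarith
  let f : ℕ → ℝ → ℝ := fun n t => max (t - ε n) 0
  have hf : ∀ n, Continuous (f n) := fun n => by fun_prop
  let φ : ℕ → ℝ → ℝ := fun n t => (√(max t (ε n)))⁻¹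
  have hφ' : ∀ n t, 0 < max t (ε n) := fun n t => lt_max_of_lt_right (hε n)
  have hφ : ∀ n, Continuous (φ n) := fun n => by
    refine Continuous.inv₀ (by fun_prop) fun t => (Real.sqrt_pos.2 (hφ' n t)).ne'
  refine ⟨fun n => rp (cfc (f n) h), fun n => cfc (φ n) h, fun n => rp_proj _, fun n => ?_,
    fun n => hsag _, fun m n => rp_commute (hsag _) (hcomm _ _), fun n => ?_,
    fun n => ?_, fun z => ?_⟩
  · refine rp_mul_eq ?_
    let ψ : ℝ → ℝ := fun t => f n t / max (t - ε (n + 1)) (ε n - ε (n + 1))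
    have hψ : Continuous ψ := by
      refine (hf n).div (by fun_prop) fun t => (lt_max_of_lt_right (hε' n)).ne'
    have : cfc ψ h * cfc (f (n + 1)) h = cfc (f n) h := hm _ _ _ hψ (hf _) fun t => by
      simp only [ψ, f]
      rcases le_total t (ε n) with ht | ht
      · rw [max_eq_right (a := t - ε n) (by linarith)]; simp
      · have := hε' n
        rw [max_eq_left (a := t - ε (n + 1)) (b := ε n - ε (n + 1)) (by linarith),
          max_eq_left (a := t - ε (n + 1)) (b := 0) (by linarith)]
        field_simp [show t - ε (n + 1) ≠ 0 by linarith]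
    rw [← this, mul_assoc, mul_rp]
  · exact rp_commute hsa (by simpa only [hid] using hcomm (f n) fun t => t)
  · have h1 : cfc (φ n) h * h * cfc (φ n) h = cfc (fun t => φ n t * t * φ n t) h := by
      have h0 := hm (φ n) (fun t => t) (fun t => φ n t * t) (hφ n) continuous_id (fun t => rfl)
      rw [hid] at h0
      rw [h0, hm (fun t => φ n t * t) (φ n) (fun t => φ n t * t * φ n t) ((hφ n).mul continuous_id) (hφ n) (fun t => rfl)]
    have hc : Continuous fun t => φ n t * t * φ n t := ((hφ n).mul continuous_id).mul (hφ n)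
    have h2 : cfc (f n) h * (1 - cfc (fun t => φ n t * t * φ n t) h) = 0 := by
      rw [mul_sub, mul_one, sub_eq_zero, eq_comm]
      refine hm _ _ _ (hf n) hc fun t => ?_
      simp only [f, φ]
      rcases le_total t (ε n) with ht | ht
      · rw [max_eq_right (a := t - ε n) (by linarith)]; simp
      · rw [max_eq_left ht, max_eq_left (by linarith)]
        have h0 : 0 < t := (hε n).trans_le ht
        have := Real.mul_self_sqrt h0.le
        have h3 : √t ≠ 0 := (Real.sqrt_pos.2 h0).ne'
        have h4 : (√t)⁻¹ * t * (√t)⁻¹ = 1 := by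
          field_simp; nlinarith
        rw [h4, mul_one]
    have h3 := (rp_ker _ _).1 h2
    rw [mul_sub, mul_one, sub_eq_zero] at h3
    rw [h1, ← (rp_commute (hsag _) (hcomm _ _)).eq]
    exact h3.symm
  · constructor
    · intro hz n
      rw [← rp_ker]
      have hz' : h * z = 0 := by rw [hh, mul_assoc, hz, mul_zero]
      have : cfc (fun t => f n t / max t (ε n)) h * cfc (fun t : ℝ => t) h = cfc (f n) h :=
        hm _ _ _ ((hf n).div (by fun_prop) fun t => (hφ' n t).ne') continuous_id fun t => by
          simp only [f]
          rcases le_total t (ε n) with ht | ht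
          · rw [max_eq_right (a := t - ε n) (by linarith)]; simp
          · have h0 : 0 < t := (hε n).trans_le ht
            rw [max_eq_left ht]
            field_simp
      rw [← this, hid, mul_assoc, hz', mul_zero]
    · intro hz
      apply mul_eq_zero_of_star_mul
      have hz' : ∀ n, cfc (f n) h * z = 0 := fun n => (rp_ker _ _).2 (hz n)
      have hb : ∀ n, ‖h * z‖ ≤ ε n * ‖z‖ := fun n => by
        have h1 : h - cfc (f n) h = cfc (fun t => t - f n t) h := by
          rw [cfc_sub (fun t : ℝ => t) (f n) h continuous_id.continuousOn (hf n).continuousOn, hid]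
        have h2 : ‖h - cfc (f n) h‖ ≤ ε n := by
          rw [h1]
          refine norm_cfc_le (hε n).le fun t ht => ?_
          have := hpos t ht
          have := hε n
          simp only [f, Real.norm_eq_abs]
          rcases le_total t (ε n) with ht | ht
          · rw [max_eq_right (by linarith), abs_le]; constructor <;> linarith
          · rw [max_eq_left (by linarith), abs_le]; constructor <;> linarith
        have h3 : h * z = (h - cfc (f n) h) * z := by rw [sub_mul, hz' n, sub_zero]
        rw [h3]
        exact (norm_mul_le _ _).trans (mul_le_mul_of_nonneg_right h2 (norm_nonneg _))
      have ht : Filter.Tendsto (fun n => ε n * ‖z‖) Filter.atTop (nhds (0 * ‖z‖)) :=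
        tendsto_one_div_add_atTop_nhds_zero_nat.mul_const _
      rw [zero_mul] at ht
      exact norm_le_zero_iff.1 (ge_of_tendsto' ht hb)

/-- The support of `x` is an orthogonal sum of projections `star (x * c n) * (x * c n)`. -/
theorem exists_spectral (x : A) : ∃ c e : ℕ → A, (∀ n, IsProjection (e n)) ∧
    (∀ n, star (x * c n) * (x * c n) = e n) ∧ (∀ m n, m ≠ n → e m * e n = 0) ∧
    (∀ m n, m ≠ n → star (x * c m) * (x * c n) = 0) ∧
    ∀ z, x * z = 0 ↔ ∀ n, e n * z = 0 := by
  obtain ⟨p, b, hp, hpp, hb, hpb, hph, hbp, hk⟩ := exists_spectral_filtration x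
  let q : ℕ → A := fun n => Nat.casesOn n 0 p
  have hq : ∀ n, IsProjection (q n) := fun n => by
    cases n with
    | zero => exact IsProjection.zero
    | succ n => exact hp n
  have hqq1 : ∀ n, q n * q (n + 1) = q n := fun n => by
    cases n with
    | zero => simp [q]
    | succ n => exact hpp n
  have hqq : ∀ m n, m ≤ n → q m * q n = q m := fun m n hmn => by
    induction n, hmn using Nat.le_induction with
    | base => exact (hq m).2
    | succ n _ ih => rw [← ih, mul_assoc, hqq1]
  have hqq' : ∀ m n, m ≤ n → q n * q m = q m := fun m n hmn =>
    (hq m).mul_comm_of_eq_left (hq n) (hqq m n hmn)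
  have hqb : ∀ m n, Commute (q m) (b n) := fun m n => by
    cases m with
    | zero => exact Commute.zero_left _
    | succ m => exact hpb m n
  have hqh : ∀ n, Commute (q n) (star x * x) := fun n => by
    cases n with
    | zero => exact Commute.zero_left _
    | succ n => exact hph n
  let e : ℕ → A := fun n => q (n + 1) - q n
  have he : ∀ n, IsProjection (e n) := fun n => (hq _).sub (hq _) (hqq' _ _ (Nat.le_succ n))
  have heb : ∀ m n, Commute (e m) (b n) := fun m n => (hqb (m + 1) n).sub_left (hqb m n)
  have heh : ∀ n, Commute (e n) (star x * x) := fun n => (hqh (n + 1)).sub_left (hqh n)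
  have hlt : ∀ m n, m < n → e m * e n = 0 := fun m n hmn => by
    simp only [e, mul_sub, sub_mul]
    rw [hqq _ _ (show m + 1 ≤ n + 1 by omega), hqq _ _ (show m + 1 ≤ n by omega),
      hqq _ _ (show m ≤ n + 1 by omega), hqq _ _ (show m ≤ n by omega)]
    simp
  have hee : ∀ m n, m ≠ n → e m * e n = 0 := fun m n hmn => by
    rcases lt_or_gt_of_ne hmn with h | h
    · exact hlt _ _ h
    · exact (he n).mul_eq_zero_symm (he m) (hlt _ _ h)
  have hform : ∀ m n, star (x * (b m * e m)) * (x * (b n * e n))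
      = b m * (star x * x) * b n * (e m * e n) := fun m n => by
    simp only [star_mul, (he m).1, (hb m).star_eq]
    calc e m * b m * star x * (x * (b n * e n)) = (e m * b m) * (star x * x) * b n * e n := by
          simp only [mul_assoc]
      _ = b m * (e m * (star x * x)) * b n * e n := by rw [(heb m m).eq]; simp only [mul_assoc]
      _ = b m * (star x * x) * (e m * b n) * e n := by rw [(heh m).eq]; simp only [mul_assoc]
      _ = _ := by rw [(heb m n).eq]; simp only [mul_assoc]
  refine ⟨fun n => b n * e n, e, he, fun n => ?_, hee, fun m n hmn => ?_, fun z => ?_⟩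
  · rw [hform, (he n).2]
    have : p n * e n = e n := by
      simp only [e, mul_sub]
      rw [show p n = q (n + 1) from rfl, (hq (n + 1)).2, hqq' _ _ (Nat.le_succ n)]
    rw [← this, ← mul_assoc, hbp]
  · rw [hform, hee _ _ hmn, mul_zero]
  · rw [hk]
    constructor
    · intro h n
      have : q n * z = 0 := by
        cases n with
        | zero => simp [q]
        | succ n => exact h n
      simp only [e, sub_mul, this, sub_zero]
      exact h n
    · intro h n
      have : ∀ n, q n * z = 0 := fun n => by
        induction n with
        | zero => simp [q]
        | succ n ih => 
          have := h n
          simpa [e, sub_mul, ih] using this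
      exact this (n + 1)

/-- Countable addability of orthogonal partial isometries whose pairwise products vanish. -/
theorem exists_sum {ι : Type*} [Countable ι] (μ e : ι → A) (he : ∀ i, IsProjection (e i))
    (hμ : ∀ i, star (μ i) * μ i = e i) (hdom : ∀ i j, i ≠ j → star (μ i) * μ j = 0)
    (hran : ∀ i j, i ≠ j → μ i * star (μ j) = 0) (hsq : ∀ i j, μ i * μ j = 0) :
    ∃ v E : A, IsProjection E ∧ star v * v = E ∧ (∀ i, E * e i = e i) ∧
      (∀ z, (∀ i, e i * z = 0) → E * z = 0) ∧ (∀ y, (∀ i, y * μ i = 0) → y * v = 0) := by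
  have hss : ∀ i j, star (μ i) * star (μ j) = 0 := fun i j => by
    rw [← star_mul, hsq, star_zero]
  have hm : ∀ i, μ i * (star (μ i) * μ i) = μ i := fun i => by
    rw [hμ, (he i).mul_eq_self (hμ i)]
  have hs : ∀ i, star (μ i) * (μ i * star (μ i)) = star (μ i) := fun i => by
    rw [← mul_assoc, hμ, (he i).mul_star_self (hμ i)]
  have hsq' : ∀ i j z, μ i * (μ j * z) = 0 := fun i j z => by rw [← mul_assoc, hsq, zero_mul]
  have hss' : ∀ i j z, star (μ i) * (star (μ j) * z) = 0 := fun i j z => by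
    rw [← mul_assoc, hss, zero_mul]
  have hdom' : ∀ i j z, i ≠ j → star (μ i) * (μ j * z) = 0 := fun i j z h => by
    rw [← mul_assoc, hdom i j h, zero_mul]
  have hran' : ∀ i j z, i ≠ j → μ i * (star (μ j) * z) = 0 := fun i j z h => by
    rw [← mul_assoc, hran i j h, zero_mul]
  let f : ι → A := fun i => μ i * star (μ i)
  have hf : ∀ i, IsProjection (f i) := fun i => (he i).mul_star (hμ i)
  let G : ι → A := fun i => e i + μ i + star (μ i) + f i
  have hG : ∀ i, star (G i) = G i := fun i => by
    simp only [G, f, star_add, star_mul, star_star, (he i).1]; abel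
  have hGG : ∀ i, G i * G i = (2 : ℝ) • G i := fun i => by
    simp only [G, f, ← hμ, mul_add, add_mul, mul_assoc, hm, hs, hsq, hss, hsq', hss',
      mul_zero, two_smul]
    abel
  have hGG' : ∀ i j, i ≠ j → G i * G j = 0 := fun i j h => by
    simp only [G, f, ← hμ, mul_add, add_mul, mul_assoc, hdom _ _ h, hran _ _ h, hsq, hss,
      hdom' _ _ _ h, hran' _ _ _ h, hsq', hss', mul_zero, add_zero]
  have heG : ∀ i, e i * G i = e i + star (μ i) := fun i => by
    simp only [G, f, ← hμ, mul_add, mul_assoc, hm, hs, hsq, hsq',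
      mul_zero, add_zero]
  have hfG : ∀ i, f i * G i = f i + μ i := fun i => by
    simp only [G, f, ← hμ, mul_add, mul_assoc, hm, hs, hss, hss',
      mul_zero, add_zero, zero_add]
    abel
  have hef : ∀ i j, e i * f j = 0 := fun i j => by
    simp only [f, ← hμ, mul_assoc, hsq', mul_zero]
  have hfe : ∀ i j, f i * e j = 0 := fun i j => by
    simp only [f, ← hμ, mul_assoc, hss', mul_zero]
  have heG' : ∀ i j, i ≠ j → e i * G j = 0 := fun i j h => by
    simp only [G, f, ← hμ, mul_add, mul_assoc, hran _ _ h, hsq,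
      hran' _ _ _ h, hsq', mul_zero, add_zero]
  have hfG' : ∀ i j, i ≠ j → f i * G j = 0 := fun i j h => by
    simp only [G, f, ← hμ, mul_add, mul_assoc, hdom _ _ h, hss,
      hdom' _ _ _ h, hss', mul_zero, add_zero]
  let g : ι → A := fun i => (2⁻¹ : ℝ) • G i
  have hg : ∀ i, IsProjection (g i) := fun i => by
    refine ⟨by simp [g, hG], ?_⟩
    simp only [g, smul_mul_smul_comm, hGG, smul_smul]
    norm_num
  obtain ⟨P, hP, hPg, hgP, -, hPl⟩ := exists_sup_proj g hg
  obtain ⟨E, hE, hEe, heE, hEr, hEl⟩ := exists_sup_proj e he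
  obtain ⟨F, hF, hFf, hfF, hFr, hFl⟩ := exists_sup_proj f hf
  have hGP : ∀ i, (2⁻¹ : ℝ) • (G i * P) = (2⁻¹ : ℝ) • G i := fun i => by
    simpa only [g, smul_mul_assoc] using hgP i
  have hhP : ∀ i, (e i + f i) * P = g i := fun i => by
    have h1 : (g i - (e i + f i)) * P = 0 := hPl _ fun j => by
      simp only [g, mul_smul_comm, sub_mul, add_mul, smul_mul_assoc, smul_sub]
      rcases eq_or_ne i j with rfl | h
      · rw [hGG, heG, hfG]
        simp only [G]
        module
      · rw [hGG' _ _ h, heG' _ _ h, hfG' _ _ h]; simp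
    rw [sub_mul, sub_eq_zero, hgP] at h1
    exact h1.symm
  have hPh : ∀ i, P * (e i + f i) = g i := fun i => by
    have := congrArg star (hhP i)
    simpa only [star_mul, star_add, hP.1, (he i).1, (hf i).1, (hg i).1] using this
  have h2 : ∀ a : A, (2 : ℝ) • (2⁻¹ : ℝ) • a = a := fun a => by
    rw [smul_smul]; norm_num
  have hPe : ∀ i, (2 : ℝ) • (P * e i) = e i + μ i := fun i => by
    have : P * e i = (P * (e i + f i)) * e i := by
      rw [mul_assoc, add_mul, (he i).2, hfe, add_zero]
    rw [this, hPh]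
    simp only [g, smul_mul_assoc, h2]
    have := congrArg star (heG i)
    simpa only [star_mul, hG, star_add, star_star, (he i).1] using this
  have hfP : ∀ i, (2 : ℝ) • (f i * P) = f i + μ i := fun i => by
    have : f i * P = f i * ((e i + f i) * P) := by
      rw [← mul_assoc, mul_add, (hf i).2, hfe, zero_add]
    rw [this, hhP]
    simp only [g, mul_smul_comm, h2]
    exact hfG i
  have hFe : ∀ i, F * e i = 0 := fun i => hFr _ fun j => hfe j i
  have hfE : ∀ i, f i * E = 0 := fun i => hEl _ fun j => hfe i j
  have hfμ : ∀ i, f i * μ i = μ i := fun i => by simp only [f, mul_assoc, hm]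
  have hFμ : ∀ i, F * μ i = μ i := fun i => by rw [← hfμ, ← mul_assoc, hFf]
  have hμE : ∀ i, μ i * E = μ i := fun i => by
    rw [← (he i).mul_eq_self (hμ i), mul_assoc, heE]
  let v : A := (2 : ℝ) • (F * P * E)
  have hve : ∀ i, v * e i = μ i := fun i => by
    simp only [v, smul_mul_assoc, mul_assoc, hEe]
    rw [← mul_smul_comm, hPe, mul_add, hFe, hFμ, zero_add]
  have hfv : ∀ i, f i * v = μ i := fun i => by
    simp only [v, mul_smul_comm, ← mul_assoc, hfF]
    rw [← smul_mul_assoc, hfP, add_mul, hfE, hμE, zero_add]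
  have hvE : v * E = v := by
    simp only [v, smul_mul_assoc, mul_assoc, hE.2]
  have hFv : F * v = v := by
    simp only [v, mul_smul_comm, ← mul_assoc, hF.2]
  refine ⟨v, E, hE, ?_, hEe, hEr, fun y hy => ?_⟩
  · have : (star v * v - E) * E = 0 := hEl _ fun i => by
      have h1 : star v * f i = star (μ i) := by
        have := congrArg star (hfv i)
        simpa only [star_mul, (hf i).1] using this
      rw [sub_mul, hEe, mul_assoc, hve, ← hfμ, ← mul_assoc, h1, hμ, sub_self]
    rw [sub_mul, mul_assoc, hvE, hE.2, sub_eq_zero] at this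
    exact this
  · have : y * F = 0 := hFl _ fun i => by simp only [f, ← mul_assoc, hy, zero_mul]
    rw [← hFv, ← mul_assoc, this, zero_mul]

theorem good_of_mul_self_eq_zero {x : A} (hx : x * x = 0) : Good x := by
  obtain ⟨c, e, he, hμ, hee, hdom, hk⟩ := exists_spectral x
  have hex : ∀ n, e n * x = 0 := (hk x).1 hx
  have hme : ∀ n, x * c n * e n = x * c n := fun n => (he n).mul_eq_self (hμ n)
  obtain ⟨v, E, hE, hvE, hEe, hEr, hy⟩ := exists_sum (fun n => x * c n) e he hμ hdom
    (fun i j h => by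
      rw [← hme i, ← (he j).mul_star_self (hμ j), mul_assoc, ← mul_assoc (e i), hee _ _ h,
        zero_mul, mul_zero])
    (fun i j => by
      rw [← hme i, mul_assoc, ← mul_assoc (e i), hex, zero_mul, mul_zero])
  refine ⟨v, ?_, fun y h => hy y fun i => by rw [← mul_assoc, h, zero_mul]⟩
  rw [hvE, rp_eq_of_ker hE fun z => ⟨fun h => hEr z ((hk z).1 h), fun h => (hk z).2 fun i => by
    rw [← (hE.mul_comm_of_eq_right (he i) (hEe i)), mul_assoc, h, mul_zero]⟩]

/-- Polar decomposition of self-adjoint elements. -/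
theorem exists_polar_of_isSelfAdjoint {s : A} (hs : IsSelfAdjoint s) : ∃ u a : A,
    IsSelfAdjoint u ∧ u * a = s ∧ a * u = s ∧ IsProjection (u * u) ∧ rp a = u * u ∧ lp a = u * u ∧
    u * u * u = u ∧ ∀ b, Commute (s * s) b → Commute a b := by
  let _ : PartialOrder A := CStarAlgebra.spectralOrder A
  have : StarOrderedRing A := CStarAlgebra.spectralOrderedRing A
  have hpsa : star (s⁺) = s⁺ := (CFC.posPart_nonneg s).isSelfAdjoint.star_eq
  have hnsa : star (s⁻) = s⁻ := (CFC.negPart_nonneg s).isSelfAdjoint.star_eq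
  have hpn : s⁺ * s⁻ = 0 := CFC.posPart_mul_negPart s
  have hnp : s⁻ * s⁺ = 0 := CFC.negPart_mul_posPart s
  have hsub : s⁺ - s⁻ = s := CFC.posPart_sub_negPart s hs
  have habs : CFC.abs s = s⁺ + s⁻ := (CFC.posPart_add_negPart s hs).symm
  set p := s⁺
  set n := s⁻
  have hP := rp_proj p
  have hN := rp_proj n
  have h1 : rp p * p = p := by simpa [hP.1, hpsa] using congrArg star (mul_rp p)
  have h2 : rp n * n = n := by simpa [hN.1, hnsa] using congrArg star (mul_rp n)
  have h3 : rp p * n = 0 := (rp_ker _ _).1 hpn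
  have h4 : rp n * p = 0 := (rp_ker _ _).1 hnp
  have h5 : n * rp p = 0 := by simpa [hP.1, hnsa] using congrArg star h3
  have h6 : p * rp n = 0 := by simpa [hN.1, hpsa] using congrArg star h4
  have h7 : rp n * rp p = 0 := (rp_ker _ _).1 h5
  have h8 : rp p * rp n = 0 := (rp_ker _ _).1 h6
  have huu : (rp p - rp n) * (rp p - rp n) = rp p + rp n := by
    simp [mul_sub, sub_mul, hP.2, hN.2, h7, h8]
  have hrp : rp (p + n) = rp p + rp n := rp_eq_of_ker (hP.add hN h8) fun z => by
    constructor
    · intro h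
      have e1 : p * z = 0 := by
        have := congrArg (rp p * ·) h
        simpa [← mul_assoc, mul_add, h1, h3] using this
      have e2 : n * z = 0 := by
        have := congrArg (rp n * ·) h
        simpa [← mul_assoc, mul_add, h2, h4] using this
      rw [add_mul, (rp_ker _ _).1 e1, (rp_ker _ _).1 e2, add_zero]
    · intro h
      have e0 : (p + n) * (rp p + rp n) = p + n := by
        simp [mul_add, add_mul, mul_rp, h5, h6]
      rw [← e0, mul_assoc, h, mul_zero]
  refine ⟨rp p - rp n, p + n, ?_, ?_, ?_, huu ▸ hP.add hN h8, by rw [huu, hrp], ?_, ?_, ?_⟩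
  · simp [isSelfAdjoint_iff, hP.1, hN.1]
  · simp [mul_add, sub_mul, h1, h2, h3, h4, hsub, ← sub_eq_add_neg]
  · simp [mul_sub, add_mul, mul_rp, h5, h6, hsub]
  · rw [huu, ← hrp, lp, star_add, hpsa, hnsa]
  · rw [huu]; simp [mul_sub, add_mul, hP.2, hN.2, h7, h8]
  · intro b hb
    rw [← habs]
    have : Commute (star s * s) b := by rwa [hs.star_eq]
    exact this.cfcₙ_nnreal _

/-- Parallelogram law: the right projection of `e * f` is equivalent to its left projection. -/
theorem good_mul_proj {e f : A} (he : IsProjection e) (hf : IsProjection f) : Good (e * f) := by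
  have hs : IsSelfAdjoint (e + f - 1) := by simp [isSelfAdjoint_iff, he.1, hf.1]
  have hsf : (e + f - 1) * f = e * f := by simp [sub_mul, add_mul, hf.2]
  have hes : e * (e + f - 1) = e * f := by simp [mul_sub, mul_add, he.2]
  have hfs : f * (e + f - 1) = f * e := by simp [mul_sub, mul_add, hf.2]
  have hse : (e + f - 1) * e = f * e := by simp [sub_mul, add_mul, he.2]
  obtain ⟨u, a, hu, hua, hau, huu, hra, hla, huuu, hc⟩ := exists_polar_of_isSelfAdjoint hs
  set s := e + f - 1
  have haf : Commute a f := hc f <| by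
    rw [Commute, SemiconjBy, mul_assoc, hsf, ← mul_assoc, hse, ← mul_assoc, hfs, mul_assoc f e s,
      hes, ← mul_assoc]
  have huf : Commute (u * u) f := hra ▸ rp_commute hf.1 haf
  have hua' : u * s = a := by
    have := lp_mul a
    rwa [hla, mul_assoc, hua] at this
  have hue : u * f = e * u := by
    have h : (u * f - e * u) * a = 0 := by
      rw [sub_mul, mul_assoc, mul_assoc, ← haf.eq, hua, ← mul_assoc, hua, hsf, hes, sub_self]
    have e1 : u * f * (u * u) = u * f := by
      rw [mul_assoc, ← huf.eq, ← mul_assoc, ← mul_assoc, huuu]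
    have e2 : e * u * (u * u) = e * u := by rw [mul_assoc, ← mul_assoc u u u, huuu]
    rw [lp_ker, hla, sub_mul, e1, e2, sub_eq_zero] at h
    exact h
  have e1 : f * (u * u * f) = u * u * f := by
    rw [← mul_assoc, ← huf.eq, mul_assoc (u * u), hf.2]
  have hproj : IsProjection (u * u * f) :=
    ⟨by rw [star_mul, huu.1, hf.1, huf.eq], by rw [mul_assoc (u * u), e1, ← mul_assoc, huu.2]⟩
  have hrp : rp (e * f) = u * u * f := rp_eq_of_ker hproj fun z => by
    rw [← hsf, ← hra, mul_assoc, mul_assoc, ← rp_ker]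
    constructor
    · intro h
      rw [← hua', mul_assoc, h, mul_zero]
    · intro h
      rw [← hua, mul_assoc, h, mul_zero]
  refine ⟨u * f, ?_, fun y hy => ?_⟩
  · rw [hrp, star_mul, hu.star_eq, hf.1, mul_assoc, ← mul_assoc u, huf.eq, ← mul_assoc, hf.2]
  · have h1 : y * e * a = 0 := by
      have : y * e * s = 0 := by rw [mul_assoc, hes, hy]
      have h2 : a = s * u := by
        have := mul_rp a
        rwa [hra, ← mul_assoc, hau, eq_comm] at this
      rw [h2, ← mul_assoc, this, zero_mul]
    rw [lp_ker, hla] at h1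
    rw [hue, ← mul_assoc, ← huuu, ← mul_assoc, h1, zero_mul]

end RickartCStar

namespace RickartCStar

variable {A : Type*} [CStarAlgebra A]

theorem exists_orthogonal_copies {T : A} (hT : IsProjection T) {V W γ : ℕ → A}
    (hV : ∀ i, star (V i) * V i = T) (hTV : ∀ i, T * V i = V i) (hTW : ∀ i, T * W i = W i)
    (hW : ∀ i, star (W i) * W i = γ i) (hVW : ∀ i, star (V i) * W i = 0) :
    ∃ K : ℕ → A, (∀ i, T * K i = K i) ∧ (∀ i, star (K i) * K i = γ i) ∧
      ∀ i j, i ≠ j → star (K i) * K j = 0 := by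
  let Q : ℕ → A := fun n => Nat.rec T (fun i q => q * V i) n
  have hQs : ∀ i, Q (i + 1) = Q i * V i := fun i => rfl
  have hTQ : ∀ i, T * Q i = Q i := fun i => by
    induction i with
    | zero => exact hT.2
    | succ i ih => rw [hQs, ← mul_assoc, ih]
  have hQQ : ∀ i, star (Q i) * Q i = T := fun i => by
    induction i with
    | zero => exact (congrArg (· * T) hT.1).trans hT.2
    | succ i ih => rw [hQs, star_mul, mul_assoc, ← mul_assoc (star (Q i)), ih, hTV, hV]
  have hWV : ∀ i, star (W i) * V i = 0 := fun i => by simpa using congrArg star (hVW i)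
  have hKQ : ∀ i j, i + 1 ≤ j → star (Q i * W i) * Q j = 0 := fun i j hij => by
    induction j, hij using Nat.le_induction with
    | base => rw [hQs, star_mul, mul_assoc, ← mul_assoc (star (Q i)), hQQ, hTV, hWV]
    | succ j _ ih => rw [hQs, ← mul_assoc, ih, zero_mul]
  have hlt : ∀ i j, i < j → star (Q i * W i) * (Q j * W j) = 0 := fun i j hij => by
    rw [← mul_assoc, hKQ i j hij, zero_mul]
  refine ⟨fun i => Q i * W i, fun i => by rw [← mul_assoc, hTQ], fun i => ?_, fun i j hij => ?_⟩
  · rw [star_mul, mul_assoc, ← mul_assoc (star (Q i)), hQQ, hTW, hW]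
  · rcases lt_or_gt_of_ne hij with h | h
    · exact hlt i j h
    · simpa using congrArg star (hlt j i h)

variable [RickartCStar A]

/-- Hilbert hotel: `T + γ` embeds into `T` if `T` contains infinitely many orthogonal copies of
each of the pieces `g n` of `γ`. -/
theorem sub_of_copies {T γ : A} (hT : IsProjection T) (hγ : IsProjection γ) (hTγ : T * γ = 0)
    {g : ℕ → A} (hg : ∀ n, IsProjection (g n)) (hgg : ∀ m n, m ≠ n → g m * g n = 0)
    (hγg : ∀ n, γ * g n = g n)
    (hgγ : ∀ z, (∀ n, g n * z = 0) → γ * z = 0) {K : ℕ × ℕ → A} (hTK : ∀ i, T * K i = K i)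
    (hK : ∀ i, star (K i) * K i = g i.1) (hKK : ∀ i j, i ≠ j → star (K i) * K j = 0) :
    Sub (T + γ) T := by
  obtain ⟨k, hk0, hks⟩ : ∃ k : ℕ → ℕ → A, (∀ n, k n 0 = g n) ∧ ∀ n l, k n (l + 1) = K (n, l) :=
    ⟨fun n l => Nat.casesOn l (g n) fun l => K (n, l), fun _ => rfl, fun _ _ => rfl⟩
  have hk : ∀ n l, star (k n l) * k n l = g n := fun n l => by
    cases l with
    | zero => rw [hk0, (hg n).1, (hg n).2]
    | succ l => rw [hks, hK]
  have hTk : ∀ n l, T * k n (l + 1) = k n (l + 1) := fun n l => by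
    rw [hks, hTK]
  have hgT : ∀ n, g n * T = 0 := fun n => by
    rw [← (hγ.mul_comm_of_eq_right (hg n) (hγg n)), mul_assoc, hT.mul_eq_zero_symm hγ hTγ, mul_zero]
  have hgk : ∀ m n l, star (g m) * k n (l + 1) = 0 := fun m n l => by
    rw [(hg m).1, ← hTk, ← mul_assoc, hgT, zero_mul]
  have hkk : ∀ n l m l', (n ≠ m ∨ l ≠ l') → star (k n l) * k m l' = 0 := fun n l m l' h => by
    rcases l with _ | l <;> rcases l' with _ | l'
    · rw [hk0, hk0, (hg n).1, hgg n m (by simpa using h)]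
    · rw [hk0, hgk]
    · rw [hk0]
      simpa using congrArg star (hgk m n l)
    · rw [hks, hks, hKK (n, l) (m, l')]
      rintro ⟨⟩
      simp at h
  have hkκ : ∀ n l, k n l * star (k n l) * k n l = k n l := fun n l =>
    (hg n).mul_star_mul (hk n l)
  have hκ : ∀ n l, IsProjection (k n l * star (k n l)) := fun n l => (hg n).mul_star (hk n l)
  have key : ∀ ε : ℕ, ∃ v E : A, IsProjection E ∧ star v * v = E ∧
      (∀ n j, E * k n (2 * j + ε) = k n (2 * j + ε)) ∧
      (∀ y, (∀ n j, y * k n (2 * j + ε) = 0) → y * E = 0) ∧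
      (∀ y, (∀ n j, y * k n (2 * j + ε + 1) = 0) → y * v = 0) := fun ε => by
    obtain ⟨v, E, hE, hvE, hEe, hEr, hy⟩ := exists_sum
      (fun i : ℕ × ℕ => k i.1 (2 * i.2 + ε + 1) * star (k i.1 (2 * i.2 + ε)))
      (fun i => k i.1 (2 * i.2 + ε) * star (k i.1 (2 * i.2 + ε)))
      (fun i => hκ _ _)
      (fun i => by
        rw [star_mul, star_star, mul_assoc, ← mul_assoc (star (k i.1 (2 * i.2 + ε + 1))), hk,
          (hg _).mul_star_self (hk _ _)])
      (fun i j h => by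
        rw [star_mul, mul_assoc, ← mul_assoc (star (k i.1 (2 * i.2 + ε + 1))), hkk, zero_mul,
          mul_zero]
        by_contra! h'
        exact h (Prod.ext h'.1 (by omega)))
      (fun i j h => by
        rw [star_mul, star_star, mul_assoc, ← mul_assoc (star (k i.1 (2 * i.2 + ε))), hkk,
          zero_mul, mul_zero]
        by_contra! h'
        exact h (Prod.ext h'.1 (by omega)))
      (fun i j => by
        rw [mul_assoc, ← mul_assoc (star (k i.1 (2 * i.2 + ε))), hkk, zero_mul, mul_zero]
        right; omega)
    refine ⟨v, E, hE, hvE, fun n j => ?_, fun y h => ?_, fun y h => ?_⟩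
    · rw [← hkκ n (2 * j + ε), ← mul_assoc, hEe (n, j)]
    · have := hEr (star y) fun i => by
        rw [mul_assoc, ← star_mul, h, star_zero, mul_zero]
      simpa [hE.1] using congrArg star this
    · exact hy y fun i => by rw [← mul_assoc, h, zero_mul]
  obtain ⟨v₁, E₁, hE₁, hv₁, hEk₁, hEl₁, hl₁⟩ := key 0
  obtain ⟨v₂, E₂, hE₂, hv₂, hEk₂, hEl₂, hl₂⟩ := key 1
  have hvv : star v₁ * v₂ = 0 := by
    have h1 : star v₂ * v₁ = 0 := hl₁ _ fun n j => by
      have : star (k n (2 * j + 0 + 1)) * v₂ = 0 := hl₂ _ fun m i =>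
        hkk n (2 * j + 0 + 1) m (2 * i + 1 + 1) (Or.inr (by omega))
      simpa using congrArg star this
    simpa using congrArg star h1
  have hvv' : star v₂ * v₁ = 0 := by simpa using congrArg star hvv
  have hEk₂' : ∀ n j, E₂ * k n (2 * j + 0) = 0 := fun n j => by
    have : star (k n (2 * j + 0)) * E₂ = 0 := hEl₂ _ fun m i =>
      hkk n (2 * j + 0) m (2 * i + 1) (Or.inr (by omega))
    simpa [hE₂.1] using congrArg star this
  have hEk₁' : ∀ n j, E₁ * k n (2 * j + 1) = 0 := fun n j => by
    have : star (k n (2 * j + 1)) * E₁ = 0 := hEl₁ _ fun m i =>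
      hkk n (2 * j + 1) m (2 * i + 0) (Or.inr (by omega))
    simpa [hE₁.1] using congrArg star this
  have hEE : E₂ * E₁ = 0 := hEl₁ _ hEk₂'
  have hEE' : E₁ * E₂ = 0 := hE₂.mul_eq_zero_symm hE₁ hEE
  have hTγp : IsProjection (T + γ) := hT.add hγ hTγ
  have hTγk : ∀ n l, (T + γ) * k n l = k n l := fun n l => by
    rcases l with _ | l
    · rw [hk0, add_mul, (hg n).mul_eq_zero_symm hT (hgT n), hγg, zero_add]
    · rw [← hTk, ← mul_assoc, add_mul, hT.2, hT.mul_eq_zero_symm hγ hTγ, add_zero]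
  have hTE : ∀ E : A, (1 - (T + γ)) * E = 0 → (T + γ) * E = E := fun E h => by
    rw [sub_mul, one_mul, sub_eq_zero] at h
    exact h.symm
  have hTE₁ : (T + γ) * E₁ = E₁ := hTE _ <| hEl₁ _ fun n j => by
    rw [sub_mul, one_mul, hTγk, sub_self]
  have hTE₂ : (T + γ) * E₂ = E₂ := hTE _ <| hEl₂ _ fun n j => by
    rw [sub_mul, one_mul, hTγk, sub_self]
  have hEEp : IsProjection (E₁ + E₂) := hE₁.add hE₂ hEE'
  have hρ : IsProjection (T + γ - (E₁ + E₂)) := hTγp.sub hEEp (by rw [mul_add, hTE₁, hTE₂])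
  have hρk : ∀ n l, (T + γ - (E₁ + E₂)) * k n l = 0 := fun n l => by
    obtain ⟨j, rfl | rfl⟩ := Nat.even_or_odd' l
    · rw [← add_zero (2 * j), sub_mul, hTγk, add_mul, hEk₁ n j, hEk₂' n j]; simp
    · rw [sub_mul, hTγk, add_mul, hEk₂ n j, hEk₁' n j]; simp
  have hρv₁ : star (T + γ - (E₁ + E₂)) * v₁ = 0 := by
    rw [hρ.1]; exact hl₁ _ fun n j => hρk _ _
  have hρv₂ : star (T + γ - (E₁ + E₂)) * v₂ = 0 := by
    rw [hρ.1]; exact hl₂ _ fun n j => hρk _ _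
  have hγE₁ : γ * E₁ = γ := by
    have : γ * (1 - E₁) = 0 := hgγ _ fun n => by
      have h1 : E₁ * g n = g n := by simpa [hk0] using hEk₁ n 0
      rw [mul_sub, mul_one, hE₁.mul_comm_of_eq_right (hg n) h1, sub_self]
    rw [mul_sub, mul_one, sub_eq_zero] at this
    exact this.symm
  have hγE₂ : γ * E₂ = 0 := by rw [← hγE₁, mul_assoc, hEE', mul_zero]
  have hγT : γ * T = 0 := hT.mul_eq_zero_symm hγ hTγ
  have hγρ : γ * (T + γ - (E₁ + E₂)) = 0 := by
    simp [mul_sub, mul_add, hγE₁, hγE₂, hγT, hγ.2]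
  have hTρ : T * (T + γ - (E₁ + E₂)) = T + γ - (E₁ + E₂) := by
    have : (T + γ) * (T + γ - (E₁ + E₂)) = T + γ - (E₁ + E₂) := by
      rw [mul_sub, hTγp.2, mul_add, hTE₁, hTE₂]
    rwa [add_mul, hγρ, add_zero] at this
  have hTv : ∀ v, (1 - T) * v = 0 → T * v = v := fun E h => by
    rw [sub_mul, one_mul, sub_eq_zero] at h
    exact h.symm
  have hTv₁ : T * v₁ = v₁ := hTv _ <| hl₁ _ fun n j => by rw [sub_mul, one_mul, hTk, sub_self]
  have hTv₂ : T * v₂ = v₂ := hTv _ <| hl₂ _ fun n j => by rw [sub_mul, one_mul, hTk, sub_self]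
  have hv₁ρ : star v₁ * (T + γ - (E₁ + E₂)) = 0 := by simpa using congrArg star hρv₁
  have hv₂ρ : star v₂ * (T + γ - (E₁ + E₂)) = 0 := by simpa using congrArg star hρv₂
  refine ⟨v₁ + v₂ + (T + γ - (E₁ + E₂)), ?_, by rw [mul_add, mul_add, hTv₁, hTv₂, hTρ]⟩
  rw [star_add, star_add, add_mul, add_mul, mul_add, mul_add, mul_add, mul_add, mul_add, mul_add,
    hv₁, hv₂, hvv, hvv', hρv₁, hρv₂, hv₁ρ, hv₂ρ, hρ.1, hρ.2]
  abel

/-- Absorption lemma. -/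
theorem sub_of_absorb {T γ x : A} (hT : IsProjection T) (hγ : IsProjection γ) (hTγ : T * γ = 0)
    (hsm : Small T) (hTx : T * x = x) (hx : ∀ z, x * z = 0 ↔ (T + γ) * z = 0) :
    Sub (T + γ) T := by
  obtain ⟨t, ht, hTt⟩ := hsm
  have hγT : γ * T = 0 := hT.mul_eq_zero_symm hγ hTγ
  have hb : ∀ z, x * γ * z = 0 ↔ γ * z = 0 := fun z => by
    rw [mul_assoc, hx, ← mul_assoc, add_mul, hTγ, hγ.2, zero_add]
  obtain ⟨c, g, hg, hW, hgg, hWW, hk⟩ := exists_spectral (x * γ)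
  have hTW : ∀ n, T * (x * γ * c n) = x * γ * c n := fun n => by
    rw [← mul_assoc, ← mul_assoc, hTx]
  have hgγ : ∀ n, γ * g n = g n := fun n => by
    have : g n * (1 - γ) = 0 := (hk _).1 ((hb _).2 (by simp [mul_sub, hγ.2])) n
    rw [mul_sub, mul_one, sub_eq_zero] at this
    exact (hg n).mul_comm_of_eq_left hγ this.symm
  have hV : ∀ n, ∃ V : A, star V * V = T ∧ T * V = V ∧ star V * (x * γ * c n) = 0 := fun n => by
    have hκ := (hg n).mul_star (hW n)
    have hκW := (hg n).mul_star_mul (hW n)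
    set κ := x * γ * c n * star (x * γ * c n) with hκd
    have hTκ : T * κ = κ := by rw [hκd, ← mul_assoc, hTW]
    have hTκp := hT.sub hκ hTκ
    set y := (T - κ) * x * T with hy
    have hTy : T * y = y := by
      rw [hy, ← mul_assoc, ← mul_assoc, mul_sub, hT.2, hTκ]
    have hry : rp y = T := rp_eq_of_ker hT fun z => by
      constructor
      · intro h
        have h1 : x * (T * z - γ * (c n * star (x * γ * c n) * (x * (T * z)))) = 0 := by
          rw [hy, mul_assoc, mul_assoc, sub_mul, ← mul_assoc T x, hTx] at h
          rw [mul_sub, ← h, hκd]; simp only [mul_assoc]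
        have h2 := congrArg (T * ·) ((hx _).1 h1)
        simp only [mul_zero] at h2
        rwa [← mul_assoc, mul_add, hT.2, hTγ, add_zero, mul_sub, ← mul_assoc, hT.2,
          ← mul_assoc, hTγ, zero_mul, sub_zero] at h2
      · intro h
        rw [hy, mul_assoc, h, mul_zero]
    have hgood : Good y := by
      refine Good.roomL (v := t) (by rw [ht, hTy]) (good_of_mul_self_eq_zero ?_)
      rw [hy]; simp only [mul_assoc, mul_mul_of_mul_eq hTt, zero_mul, mul_zero]
    obtain ⟨V, hVV, hyV⟩ := hgood
    have h1 : (T - κ) * V = V := by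
      have := hyV (1 - (T - κ)) (by
        rw [hy, ← mul_assoc, ← mul_assoc, sub_mul, hTκp.2, one_mul, sub_self, zero_mul, zero_mul])
      rw [sub_mul, one_mul, sub_eq_zero] at this
      exact this.symm
    refine ⟨V, by rw [hVV, hry], ?_, ?_⟩
    · rw [← h1, ← mul_assoc, mul_sub, hT.2, hTκ]
    · rw [← h1, star_mul, hTκp.1, mul_assoc, sub_mul, hTW, hκW, sub_self, mul_zero]
  choose V hVV hTV hVW using hV
  obtain ⟨K, hTK, hK, hKK⟩ := exists_orthogonal_copies hT (V := fun i => V i.unpair.1)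
    (W := fun i => x * γ * c i.unpair.1) (γ := fun i => g i.unpair.1) (fun i => hVV _)
    (fun i => hTV _) (fun i => hTW _) (fun i => hW _) (fun i => hVW _)
  refine sub_of_copies hT hγ hTγ hg hgg hgγ (fun z hz => (hb z).1 ((hk z).2 hz))
    (K := fun i => K (Nat.pair i.1 i.2)) (fun i => hTK _) (fun i => ?_) (fun i j h => hKK _ _ ?_)
  · simpa using hK (Nat.pair i.1 i.2)
  · intro h'
    rw [Nat.pair_eq_pair] at h'
    exact h (Prod.ext h'.1 h'.2)

theorem Good.exists_isometry {x : A} (h : Good x) :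
    ∃ w : A, star w * w = rp x ∧ lp x * w = w := by
  obtain ⟨w, hw, hxw⟩ := h
  refine ⟨w, hw, ?_⟩
  have := hxw (1 - lp x) (by rw [sub_mul, lp_mul, one_mul, sub_self])
  rw [sub_mul, one_mul, sub_eq_zero] at this
  exact this.symm

theorem goodProj_of_small {p : A} (hp : IsProjection p) (hsm : Small p) : GoodProj p := by
  intro y hpy
  obtain ⟨v, hv, hpv⟩ := hsm
  have hvp := hp.mul_eq_self hv
  have hqv := hp.mul_star_mul hv
  have hq := hp.mul_star hv
  set q := v * star v with hqd
  have hpq : p * q = 0 := by rw [hqd, ← mul_assoc, hpv, zero_mul]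
  have hqp : q * p = 0 := hp.mul_eq_zero_symm hq hpq
  have hvq : star v * q = star v := by simpa [hq.1] using congrArg star hqv
  have hα := rp_proj y
  have hyα := mul_rp y
  have hyk := rp_ker y
  set α := rp y
  have hα' := rp_proj (q * α)
  have hqα' := mul_rp (q * α)
  have hα'α : rp (q * α) * α = rp (q * α) := rp_mul_eq (by rw [mul_assoc, hα.2])
  have hsubα' : Sub (rp (q * α)) q :=
    (good_mul_proj hq hα).sub (by rw [← mul_assoc, hq.2])
  set α' := rp (q * α)
  have hαα' : α * α' = α' := hα'.mul_comm_of_eq_left hα hα'α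
  have hα'' := hα.sub hα' hαα'
  have hαα'' : α * (α - α') = α - α' := by rw [mul_sub, hα.2, hαα']
  have hα''α' : (α - α') * α' = 0 := by rw [sub_mul, hαα', hα'.2, sub_self]
  have hqα'' : q * (α - α') = 0 := by
    rw [← hαα'', ← mul_assoc, mul_sub, hqα', mul_assoc, hα.2, sub_self]
  have hα''q := hq.mul_eq_zero_symm hα'' hqα''
  have hα''d : α = (α - α') + α' := by abel
  generalize α - α' = α'' at *
  have hα''v : α'' * v = 0 := by rw [← hqv, ← mul_assoc, hα''q, zero_mul]
  have hvα'' : star v * α'' = 0 := by rw [← hvq, mul_assoc, hqα'', mul_zero]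
  have hpyα'' : p * (y * α'') = y * α'' := by rw [← mul_assoc, hpy]
  have hβ := lp_proj (y * α'')
  have hβy := lp_mul (y * α'')
  have hpβ := mul_lp_eq hp.1 hpyα''
  have hrpα'' : rp (y * α'') = α'' := rp_eq_of_ker hα'' fun z => by
    rw [mul_assoc, hyk, ← mul_assoc, hαα'']
  have hG1 : Good (y * α'') := by
    refine Good.roomL (v := v) (by rw [hv, hpyα'']) (good_of_mul_self_eq_zero ?_)
    simp only [mul_assoc, mul_mul_of_mul_eq hα''v, zero_mul, mul_zero]
  have hβp : lp (y * α'') * p = lp (y * α'') := hp.mul_comm_of_eq_right hβ hpβ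
  have hG2 : Good (star (y * α'')) := by
    refine Good.roomR (v := v * lp (y * α'')) ?_ (good_of_mul_self_eq_zero ?_)
    · rw [star_mul, mul_assoc, ← mul_assoc (star v), hv, hpβ, hβ.1, hβ.2]; rfl
    · simp only [star_mul, mul_assoc, hα''.1, mul_mul_of_mul_eq hvα'', zero_mul, mul_zero]
  obtain ⟨w, hww, hβw⟩ := hG1.exists_isometry
  obtain ⟨S, hSS, hαS⟩ := hG2.exists_isometry
  rw [lp_star] at hαS
  rw [← lp] at hSS
  rw [hrpα''] at hαS hww
  set β := lp (y * α'')
  have hp₀ := hp.sub hβ hpβ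
  have hβp₀ : β * (p - β) = 0 := by rw [mul_sub, hβp, hβ.2, sub_self]
  have hp₀β := hβ.mul_eq_zero_symm hp₀ hβp₀
  have hqp₀ : q * (p - β) = 0 := by
    rw [mul_sub, hqp, ← hpβ, ← mul_assoc, hqp, zero_mul, sub_zero]
  have hpd : p - β + β = p := by abel
  have hp₀y : (p - β) * y * α'' = 0 := by
    rw [mul_assoc, sub_mul, hpyα'', hβy, sub_self]
  have hyp₀ : y = (p - β) * y + β * y := by rw [← add_mul, hpd, hpy]
  generalize p - β = p₀ at *
  have ha := rp_proj (p₀ * y)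
  have haα'' : rp (p₀ * y) * α'' = 0 := (rp_ker _ _).1 hp₀y
  have hya := mul_rp (p₀ * y)
  have haα : rp (p₀ * y) * α = rp (p₀ * y) := rp_mul_eq (by rw [mul_assoc, hyα])
  have haα' : rp (p₀ * y) * α' = rp (p₀ * y) := by
    rw [hα''d, mul_add, haα'', zero_add] at haα; exact haα
  have hα'a : α' * rp (p₀ * y) = rp (p₀ * y) := ha.mul_comm_of_eq_left hα' haα'
  have hsuba : Sub (rp (p₀ * y)) p₀ := by
    obtain ⟨u, hu, hqu⟩ := (Sub.of_mul_eq ha hα'a).trans hsubα'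
    have huq : star u * q = star u := by simpa [hq.1] using congrArg star hqu
    have hup₀ : star u * p₀ = 0 := by rw [← huq, mul_assoc, hqp₀, mul_zero]
    refine (Good.roomR hu (good_of_mul_self_eq_zero ?_)).sub (by rw [← mul_assoc, hp₀.2])
    simp only [mul_assoc, mul_mul_of_mul_eq hup₀, zero_mul, mul_zero]
  set a := rp (p₀ * y)
  have hγ := hα'.sub ha hα'a
  have hα''a := ha.mul_eq_zero_symm hα'' haα''
  have hα''γ : α'' * (α' - a) = 0 := by rw [mul_sub, hα''α', hα''a, sub_zero]
  have hyγ : β * (y * (α'' + (α' - a))) = y * (α'' + (α' - a)) := by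
    have h1 : p₀ * (y * (α'' + (α' - a))) = 0 := by
      rw [← add_sub_assoc, ← hα''d, ← mul_assoc, mul_sub, hya, mul_assoc, hyα, sub_self]
    conv_rhs => rw [hyp₀, add_mul, mul_assoc, h1, zero_add, mul_assoc]
  have hαγ : α * (α'' + (α' - a)) = α'' + (α' - a) := by
    rw [← add_sub_assoc, ← hα''d, mul_sub, hα.2,
      ha.mul_comm_of_eq_left hα haα]
  have hsmα'' : Small α'' := by
    refine ⟨v * w, ?_, by rw [← mul_assoc, hα''v, zero_mul]⟩
    rw [star_mul, mul_assoc, ← mul_assoc (star v), hv, ← hβw, ← mul_assoc p, hpβ, hβw, hww]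
  have hsub : Sub (α'' + (α' - a)) β := by
    refine (sub_of_absorb (x := S * (y * (α'' + (α' - a)))) hα'' hγ hα''γ hsmα''
      (by rw [← mul_assoc, hαS]) fun z => ⟨fun h => ?_, fun h => ?_⟩).trans ⟨w, hww, hβw⟩
    · have h1 := congrArg (star S * ·) h
      simp only [mul_zero] at h1
      rw [mul_assoc, ← mul_assoc (star S), hSS, ← mul_assoc, hyγ, mul_assoc, hyk,
        ← mul_assoc, hαγ] at h1
      exact h1
    · rw [mul_assoc, mul_assoc, h, mul_zero, mul_zero]
  have := Sub.add hp₀ hβ hp₀β hsuba hsub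
  rwa [hpd, ← add_sub_assoc, ← hα''d, add_sub_cancel] at this

theorem GoodProj.of_equiv {p w : A} (hp : IsProjection p) (hw : star w * w = p)
    (h : GoodProj (w * star w)) : GoodProj p := by
  intro y hpy
  have hk : rp (w * y) = rp y := rp_congr fun z => by
    refine ⟨fun h => ?_, fun h => by rw [mul_assoc, h, mul_zero]⟩
    rw [← hpy, ← hw, mul_assoc, mul_assoc, ← mul_assoc w, h, mul_zero]
  obtain ⟨u, hu, hwu⟩ := h (w * y) (by rw [← mul_assoc, hp.mul_star_mul hw])
  refine ⟨star w * u, ?_, by rw [← mul_assoc, hp.mul_star_self hw]⟩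
  rw [star_mul, star_star, mul_assoc, ← mul_assoc w, hwu, hu, hk]

theorem GoodProj.add {p₁ p₂ : A} (hp₁ : IsProjection p₁) (hp₂ : IsProjection p₂)
    (h : p₁ * p₂ = 0) (h₁ : GoodProj p₁) (h₂ : GoodProj p₂) : GoodProj (p₁ + p₂) := by
  intro y hy
  have ha := rp_proj (p₁ * y)
  have hya := mul_rp (p₁ * y)
  have hs := h₁ (p₁ * y) (by rw [← mul_assoc, hp₁.2])
  have hrp : rp (p₁ * y) * rp y = rp (p₁ * y) := rp_mul_eq (by rw [mul_assoc, mul_rp])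
  set a := rp (p₁ * y)
  have hra := ha.mul_comm_of_eq_left (rp_proj y) hrp
  have h1 : p₁ * (y * (1 - a)) = 0 := by rw [← mul_assoc, mul_sub, mul_one, hya, sub_self]
  have h2 : p₂ * (y * (1 - a)) = y * (1 - a) := by
    conv_rhs => rw [← hy, mul_assoc, add_mul, h1, zero_add]
  have h3 : rp (y * (1 - a)) = rp y - a :=
    rp_eq_of_ker ((rp_proj y).sub ha hra) fun z => by
      rw [mul_assoc, rp_ker y, ← mul_assoc, mul_sub, mul_one, hra]
  have := Sub.add hp₁ hp₂ h hs (h₂ _ h2)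
  rwa [h3, add_sub_cancel] at this

theorem exists_goodProj_of_shift {τ σ v : ℕ → A} (hτ : ∀ n, IsProjection (τ n))
    (hσ : ∀ n, IsProjection (σ n)) (hv : ∀ n, star (v n) * v n = τ n) (hσv : ∀ n, σ n * v n = v n)
    (hττ : ∀ m n, m ≠ n → τ m * τ n = 0) (hσσ : ∀ m n, m ≠ n → σ m * σ n = 0)
    (hτσ : ∀ m n, τ m * σ n = 0) :
    ∃ E : A, IsProjection E ∧ (∀ n, E * τ n = τ n) ∧ (∀ y, (∀ n, y * τ n = 0) → y * E = 0) ∧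
      GoodProj E := by
  have hvσ : ∀ n, star (v n) * σ n = star (v n) := fun n => by
    simpa [(hσ n).1] using congrArg star (hσv n)
  have hvτ : ∀ n, v n * τ n = v n := fun n => (hτ n).mul_eq_self (hv n)
  have hτv : ∀ n, τ n * star (v n) = star (v n) := fun n => (hτ n).mul_star_self (hv n)
  obtain ⟨V, E, hE, hVE, hEτ, hEr, hy⟩ := exists_sum v τ hτ hv
    (fun i j h => by
      rw [← hvσ, ← hσv j, mul_assoc, ← mul_assoc (σ i), hσσ i j h, zero_mul, mul_zero])
    (fun i j h => by
      rw [← hvτ, ← hτv j, mul_assoc, ← mul_assoc (τ i), hττ i j h, zero_mul, mul_zero])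
    (fun i j => by
      rw [← hvτ, ← hσv j, mul_assoc, ← mul_assoc (τ i), hτσ i j, zero_mul, mul_zero])
  refine ⟨E, hE, hEτ, fun y h => ?_, goodProj_of_small hE ⟨V, hVE, hy _ fun i => ?_⟩⟩
  · have := hEr (star y) fun i => by simpa [(hτ i).1] using congrArg star (h i)
    simpa [hE.1] using congrArg star this
  · rw [← hσv, ← mul_assoc, hEr _ fun n => hτσ n i, zero_mul]

theorem goodProj_rp_compl_mul (x : A) : GoodProj (rp ((1 - rp x) * lp x)) := by
  have hp := rp_proj ((1 - rp x) * lp x)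
  obtain ⟨w, hw, hew⟩ := (good_mul_proj (rp_proj x).one_sub (lp_proj x)).sub
    (p := 1 - rp x) (by rw [← mul_assoc, (rp_proj x).one_sub.2])
  have hfp : lp x * rp ((1 - rp x) * lp x) = rp ((1 - rp x) * lp x) :=
    mul_rp_eq (lp_proj x).1 (by rw [mul_assoc, (lp_proj x).2])
  set p := rp ((1 - rp x) * lp x)
  have hxw : x * w = 0 := by
    rw [← hew, ← mul_assoc, mul_sub, mul_one, mul_rp, sub_self, zero_mul]
  have hwx : star w * star x = 0 := by simpa using congrArg star hxw
  have hrp : rp (star x * p) = p := rp_eq_of_ker hp fun z => by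
    rw [mul_assoc, rp_ker, ← lp, ← mul_assoc, hfp]
  have hG : Good (star x * p) := by
    refine Good.roomR (v := w) (by rw [hw, hrp]) (good_of_mul_self_eq_zero ?_)
    simp only [mul_assoc, mul_mul_of_mul_eq hwx, zero_mul, mul_zero]
  obtain ⟨t, ht, het⟩ := hG.sub (p := rp x) (by rw [← mul_assoc, ← lp_star, lp_mul])
  have hwt : star w * t = 0 := by
    have : star w * (1 - rp x) = star w := by
      simpa [(rp_proj x).1] using congrArg star hew
    rw [← het, ← this, mul_assoc, ← mul_assoc (1 - rp x), sub_mul, (rp_proj x).2, one_mul,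
      sub_self, zero_mul, mul_zero]
  refine GoodProj.of_equiv hp hw (goodProj_of_small (hp.mul_star hw) ⟨t * star w, ?_, ?_⟩)
  · rw [star_mul, star_star, mul_assoc, ← mul_assoc (star t), ht, hrp, hp.mul_star_self hw]
  · rw [mul_assoc, ← mul_assoc (star w), hwt, zero_mul, mul_zero]

theorem exists_filtration (x : A) {s : A} (hs : IsProjection s) :
    ∃ ρ v : ℕ → A, ρ 0 = s ∧ (∀ j, IsProjection (ρ j)) ∧ (∀ i j, i ≠ j → ρ i * ρ j = 0) ∧
      (∀ j, star (v j) * v j = ρ (j + 1)) ∧ (∀ j, ρ j * v j = v j) ∧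
      ∀ q, (∀ j, q * ρ j = 0) → ∀ j, q * x * ρ j = 0 := by
  obtain ⟨G, ρ, hG0, hρ0, hρs, hGs⟩ : ∃ G ρ : ℕ → A, G 0 = s ∧ ρ 0 = s ∧
      (∀ j, ρ (j + 1) = lp ((1 - G j) * x * G j)) ∧ ∀ j, G (j + 1) = G j + ρ (j + 1) := by
    let S : ℕ → A × A := fun n => Nat.rec (s, s)
      (fun _ t => (t.1 + lp ((1 - t.1) * x * t.1), lp ((1 - t.1) * x * t.1))) n
    exact ⟨fun n => (S n).1, fun n => (S n).2, rfl, rfl, fun _ => rfl, fun _ => rfl⟩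
  have hρ : ∀ j, IsProjection (ρ j) := fun j => by
    cases j with
    | zero => rwa [hρ0]
    | succ j => rw [hρs]; exact lp_proj _
  have hGρ_of : ∀ j, IsProjection (G j) → G j * ρ (j + 1) = 0 := fun j hG => by
    have := mul_lp_eq (x := (1 - G j) * x * G j) hG.one_sub.1
      (by rw [← mul_assoc, ← mul_assoc, hG.one_sub.2])
    rw [← hρs, sub_mul, one_mul, sub_eq_self] at this
    exact this
  have hG : ∀ j, IsProjection (G j) := fun j => by
    induction j with
    | zero => rwa [hG0]
    | succ j ih => rw [hGs]; exact ih.add (hρ _) (hGρ_of j ih)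
  have hGρ : ∀ j, G j * ρ (j + 1) = 0 := fun j => hGρ_of j (hG j)
  have hρG : ∀ j, ρ (j + 1) * G j = 0 := fun j => (hG j).mul_eq_zero_symm (hρ _) (hGρ j)
  have hρG' : ∀ i j, i ≤ j → ρ i * G j = ρ i := fun i j hij => by
    induction j, hij using Nat.le_induction with
    | base =>
      cases i with
      | zero => rw [hG0, hρ0, hs.2]
      | succ i => rw [hGs, mul_add, hρG, (hρ _).2, zero_add]
    | succ j _ ih => rw [hGs, mul_add, ih, ← ih, mul_assoc, hGρ, mul_zero, add_zero]
  have hlt : ∀ i j, i < j → ρ i * ρ j = 0 := fun i j hij => by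
    obtain ⟨j, rfl⟩ := Nat.exists_eq_succ_of_ne_zero (by omega : j ≠ 0)
    rw [← hρG' i j (by omega), mul_assoc, Nat.succ_eq_add_one, hGρ, mul_zero]
  have hstep : ∀ j, (1 - G (j + 1)) * x * G j = 0 := fun j => by
    have h1 := lp_mul ((1 - G j) * x * G j)
    rw [← hρs, ← mul_assoc, ← mul_assoc, mul_sub, mul_one, hρG, sub_zero] at h1
    rw [hGs, ← sub_sub, sub_mul, sub_mul, h1, sub_self]
  have hY : ∀ j, (1 - G j) * x * G j * ρ j = (1 - G j) * x * G j := fun j => by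
    have : (1 - G j) * x * G j = (1 - G j) * x * ρ j := by
      cases j with
      | zero => rw [hG0, hρ0]
      | succ j =>
        conv_lhs => rw [hGs j, mul_add, ← hGs j, hstep, zero_add]
    rw [this, mul_assoc, (hρ j).2]
  have hv : ∀ j, ∃ v, star v * v = ρ (j + 1) ∧ ρ j * v = v := fun j => by
    have hGG : (G j) * (1 - G j) = 0 := by rw [mul_sub, mul_one, (hG j).2, sub_self]
    have hGG' : (1 - G j) * (G j) = 0 := (hG j).mul_eq_zero_symm (hG j).one_sub hGG
    have := (good_of_mul_self_eq_zero (x := star ((1 - G j) * x * G j)) (by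
      simp only [star_mul, (hG j).1, (hG j).one_sub.1, mul_assoc, mul_mul_of_mul_eq hGG',
        zero_mul, mul_zero])).sub (p := ρ j)
        (by simpa only [star_mul (_ * G j), (hρ j).1] using congrArg star (hY j))
    rwa [← lp, ← hρs] at this
  choose v hv hρv using hv
  refine ⟨ρ, v, hρ0, hρ, fun i j h => ?_, hv, hρv, fun q hq j => ?_⟩
  · rcases lt_or_gt_of_ne h with h | h
    · exact hlt i j h
    · exact (hρ j).mul_eq_zero_symm (hρ i) (hlt j i h)
  · have hqG : ∀ j, q * G j = 0 := fun j => by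
      induction j with
      | zero => rw [hG0, ← hρ0, hq]
      | succ j ih => rw [hGs, mul_add, ih, hq, add_zero]
    have hGρj : G j * ρ j = ρ j := (hρ j).mul_comm_of_eq_left (hG j) (hρG' j j le_rfl)
    have h1 : q * x * G j = 0 := by
      have := congrArg (q * ·) (hstep j)
      simpa only [← mul_assoc, mul_sub, mul_one, hqG, sub_zero, mul_zero] using this
    rw [← hGρj, ← mul_assoc, h1, zero_mul]

theorem sub_rp_lp (x : A) : Sub (rp x) (lp x) := by
  have hF := goodProj_rp_compl_mul x
  have hf' := rp_proj ((1 - rp x) * lp x)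
  have hff' : lp x * rp ((1 - rp x) * lp x) = rp ((1 - rp x) * lp x) :=
    mul_rp_eq (lp_proj x).1 (by rw [mul_assoc, (lp_proj x).2])
  set f' := rp ((1 - rp x) * lp x)
  have hm := (lp_proj x).sub hf' hff'
  have hfd : lp x = lp x - f' + f' := by abel
  have hf'm : f' * (lp x - f') = 0 := by
    rw [mul_sub, hf'.2, (lp_proj x).mul_comm_of_eq_right hf' hff', sub_self]
  generalize lp x - f' = m at *
  obtain ⟨ρ, v, hρ0, hρ, hρρ, hv, hρv, hx⟩ := exists_filtration x hm.one_sub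
  have hmρ : ∀ j, m * ρ (j + 1) = ρ (j + 1) := fun j => by
    have := hρρ 0 (j + 1) (by omega)
    rw [hρ0, sub_mul, one_mul, sub_eq_zero] at this
    exact this.symm
  obtain ⟨O, hO, hOρ, hOl, hOg⟩ := exists_goodProj_of_shift (τ := fun n => ρ (2 * n + 1))
    (σ := fun n => ρ (2 * n)) (v := fun n => v (2 * n)) (fun _ => hρ _) (fun _ => hρ _)
    (fun _ => hv _) (fun _ => hρv _) (fun m n h => hρρ _ _ (by omega))
    (fun m n h => hρρ _ _ (by omega)) (fun m n => hρρ _ _ (by omega))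
  obtain ⟨E, hE, hEρ, hEl, hEg⟩ := exists_goodProj_of_shift (τ := fun n => ρ (2 * n + 1 + 1))
    (σ := fun n => ρ (2 * n + 1)) (v := fun n => v (2 * n + 1)) (fun _ => hρ _) (fun _ => hρ _)
    (fun _ => hv _) (fun _ => hρv _) (fun m n h => hρρ _ _ (by omega))
    (fun m n h => hρρ _ _ (by omega)) (fun m n => hρρ _ _ (by omega))
  have hfix : ∀ y : A, (1 - m) * y = 0 → m * y = y := fun y h => by
    rw [sub_mul, one_mul, sub_eq_zero] at h
    exact h.symm
  have hmO : m * O = O := hfix _ <| hOl _ fun n => by rw [sub_mul, one_mul, hmρ, sub_self]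
  have hmE : m * E = E := hfix _ <| hEl _ fun n => by rw [sub_mul, one_mul, hmρ, sub_self]
  have hρO : ∀ j, (∀ n, j ≠ 2 * n + 1) → O * ρ j = 0 := fun j h =>
    (hρ j).mul_eq_zero_symm hO (hOl _ fun n => hρρ _ _ (h n))
  have hρE : ∀ j, (∀ n, j ≠ 2 * n + 1 + 1) → E * ρ j = 0 := fun j h =>
    (hρ j).mul_eq_zero_symm hE (hEl _ fun n => hρρ _ _ (h n))
  have hOE : O * E = 0 := hEl _ fun n => hρO _ (by omega)
  have hOEp := hO.add hE hOE
  have hmOE : m * (O + E) = O + E := by rw [mul_add, hmO, hmE]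
  have hq := hm.sub hOEp hmOE
  have hqρ : ∀ j, (m - (O + E)) * ρ j = 0 := fun j => by
    obtain _ | j := j
    · rw [sub_mul, add_mul, hρO 0 (by omega), hρE 0 (by omega), hρ0, mul_sub, mul_one, hm.2]
      simp
    · obtain ⟨n, rfl | rfl⟩ := Nat.even_or_odd' j
      · rw [sub_mul, add_mul, hmρ, hOρ, hρE _ (by omega)]; simp
      · rw [sub_mul, add_mul, hmρ, hEρ, hρO _ (by omega)]; simp
  have hqx := hx _ hqρ
  have hf'OE : f' * (O + E) = 0 := by rw [← hmOE, ← mul_assoc, hf'm, zero_mul]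
  have hgood : GoodProj (f' + (O + E)) := hF.add hf' hOEp hf'OE (hOg.add hO hE hOE hEg)
  have hfq : m - (O + E) + (f' + (O + E)) = lp x := by rw [hfd]; abel
  have hqfq : (m - (O + E)) * (f' + (O + E)) = 0 := by
    rw [sub_mul, mul_add, mul_add _ f' (O + E), hmOE, hOEp.2, hf'.mul_eq_zero_symm hm hf'm,
      hf'.mul_eq_zero_symm hOEp hf'OE, sub_self]
  have ha := rp_proj ((m - (O + E)) * x)
  have hae : rp ((m - (O + E)) * x) * rp x = rp ((m - (O + E)) * x) :=
    rp_mul_eq (by rw [mul_assoc, mul_rp])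
  have haq : rp ((m - (O + E)) * x) * (m - (O + E)) = rp ((m - (O + E)) * x) := by
    have hs := (rp_ker _ _).1 (hqx 0)
    rw [hρ0, mul_sub, mul_one, sub_eq_zero] at hs
    rw [mul_sub, ← hs, mul_add, (rp_ker _ _).1 (hOl _ fun n => hqx _),
      (rp_ker _ _).1 (hEl _ fun n => hqx _), add_zero, sub_zero]
  have hya := mul_rp ((m - (O + E)) * x)
  set a := rp ((m - (O + E)) * x)
  have hea := ha.mul_comm_of_eq_left (rp_proj x) hae
  have h1 : (f' + (O + E)) * (x * (1 - a)) = x * (1 - a) := by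
    have h2 : (m - (O + E)) * (x * (1 - a)) = 0 := by
      rw [← mul_assoc, mul_sub, mul_one, hya, sub_self]
    have h3 : lp x * (x * (1 - a)) = x * (1 - a) := by rw [← mul_assoc, lp_mul]
    rwa [← hfq, add_mul, h2, zero_add] at h3
  have h3 : rp (x * (1 - a)) = rp x - a := rp_eq_of_ker ((rp_proj x).sub ha hea) fun z => by
    rw [mul_assoc, rp_ker x, ← mul_assoc, mul_sub, mul_one, hea]
  have hfqp := hf'.add hOEp hf'OE
  have := Sub.add hq hfqp hqfq (Sub.of_mul_eq ha (ha.mul_comm_of_eq_left hq haq)) (hgood _ h1)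
  rwa [h3, hfq, add_sub_cancel] at this

/-- Schröder–Bernstein for projections. -/
theorem exists_equiv_of_sub_of_sub {r l : A} (hr : IsProjection r) (hl : IsProjection l)
    (hrl : Sub r l) (hlr : Sub l r) : ∃ V : A, star V * V = r ∧ V * star V = l := by
  obtain ⟨u, hu, hlu⟩ := hrl
  obtain ⟨v, hv, hrv⟩ := hlr
  have hvv := hl.mul_star_mul hv
  have hw : star (v * u) * (v * u) = r := by
    rw [star_mul, mul_assoc, ← mul_assoc (star v), hv, hlu, hu]
  have hrw : r * (v * u) = v * u := by rw [← mul_assoc, hrv]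
  have hwr := hr.mul_eq_self hw
  have hf := hl.mul_star hv
  have hk := hr.sub hf (by rw [← mul_assoc, hrv])
  have hkw : (r - v * star v) * (v * u) = 0 := by
    rw [← mul_assoc, sub_mul, hrv, hvv, sub_self, zero_mul]
  have hrk : r * (r - v * star v) = r - v * star v := by
    rw [mul_sub, hr.2, ← mul_assoc, hrv]
  have hkd : r - (r - v * star v) = v * star v := by abel
  generalize v * u = w at *
  generalize r - v * star v = k at *
  obtain ⟨K, hK0, hKs⟩ : ∃ K : ℕ → A, K 0 = k ∧ ∀ n, K (n + 1) = w * K n :=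
    ⟨fun n => Nat.rec k (fun _ t => w * t) n, rfl, fun _ => rfl⟩
  have hrK : ∀ n, r * K n = K n := fun n => by
    cases n with
    | zero => rw [hK0, hrk]
    | succ n => rw [hKs, ← mul_assoc, hrw]
  have hKK : ∀ n, star (K n) * K n = k := fun n => by
    induction n with
    | zero => rw [hK0, hk.1, hk.2]
    | succ n ih => rw [hKs, star_mul, mul_assoc, ← mul_assoc (star w), hw, hrK, ih]
  obtain ⟨g, hg, hgK', -, -, hgl⟩ := exists_sup_proj (fun n => K n * star (K n))
    fun n => hk.mul_star (hKK n)
  have hgK : ∀ n, g * K n = K n := fun n => by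
    rw [← hk.mul_star_mul (hKK n), ← mul_assoc, hgK']
  have hgl' : ∀ z, (∀ n, z * K n = 0) → z * g = 0 := fun z h => hgl z fun n => by
    rw [← mul_assoc, h, zero_mul]
  have hrg : r * g = g := by
    have := hgl' (1 - r) fun n => by rw [sub_mul, one_mul, hrK, sub_self]
    rw [sub_mul, one_mul, sub_eq_zero] at this
    exact this.symm
  have hgr := hr.mul_comm_of_eq_right hg hrg
  have hgwg : g * (w * g) = w * g := by
    have := hgl' ((1 - g) * w) fun n => by
      rw [mul_assoc, ← hKs, sub_mul, one_mul, hgK, sub_self]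
    rw [mul_assoc, sub_mul, one_mul, sub_eq_zero] at this
    exact this.symm
  have hgw' : g * (star w * g) = g * star w := by
    simpa [hg.1, mul_assoc] using congrArg star hgwg
  have hrg' := hr.sub hg hrg
  have hw' : ∀ z, star w * (w * z) = r * z := fun z => by rw [← mul_assoc, hw]
  have hg' : ∀ z, g * (g * z) = g * z := fun z => by rw [← mul_assoc, hg.2]
  have hr' : ∀ z, r * (w * z) = w * z := fun z => by rw [← mul_assoc, hrw]
  have hkw' : ∀ z, k * (w * z) = 0 := fun z => by rw [← mul_assoc, hkw, zero_mul]
  have hwk : star w * k = 0 := by simpa [hk.1] using congrArg star hkw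
  have hgk : g * k = k := by rw [← hK0, hgK]
  have hwgw : w * g * star w = g - k := by
    have h1 : (k + w * g * star w) * g = g := by
      have := hgl' (1 - (k + w * g * star w)) fun n => by
        cases n with
        | zero =>
          rw [hK0]
          simp [sub_mul, add_mul, mul_assoc, hk.2, hwk]
        | succ n =>
          rw [hKs]
          simp [sub_mul, add_mul, mul_assoc, hkw', hw', hrK, hgK]
      rw [sub_mul, one_mul, sub_eq_zero] at this
      exact this.symm
    have h2 : g * (k + w * g * star w) = k + w * g * star w := by
      rw [mul_add, hgk, ← mul_assoc, hgwg]
    have h3 : (k + w * g * star w) * g = k + w * g * star w := by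
      simpa [hg.1, hk.1, mul_assoc] using congrArg star h2
    exact eq_sub_of_add_eq' (h3.symm.trans h1)
  have hwr' : star w * r = star w := by simpa [hr.1] using congrArg star hrw
  have hz₁ : star (w * g + (r - g)) * (w * g + (r - g)) = r := by
    simp only [star_add, star_mul, hg.1, hrg'.1, add_mul, mul_add, mul_sub, sub_mul, mul_assoc,
      hw', hrg, hg.2, hgwg, hr', hgw', hgr, hr.2, hwr']
    abel
  have hz₂ : (w * g + (r - g)) * star (w * g + (r - g)) = v * star v := by
    simp only [star_add, star_mul, hg.1, hrg'.1, add_mul, mul_add, mul_sub, sub_mul, mul_assoc,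
      hrg, hg.2, hgr, hr.2, hg', ← mul_assoc r g]
    rw [← mul_assoc, hwgw, ← hkd]
    abel
  generalize w * g + (r - g) = z at *
  refine ⟨star v * z, ?_, ?_⟩
  · rw [star_mul, star_star, mul_assoc, ← mul_assoc v, ← hz₂, mul_assoc, hz₁, ← mul_assoc, hz₁,
      hr.2]
  · rw [star_mul, star_star, mul_assoc, ← mul_assoc z, hz₂, mul_assoc, hv, ← mul_assoc, hv, hl.2]

theorem exists_equiv_rp_lp (x : A) : ∃ v : A, star v * v = rp x ∧ v * star v = lp x := by
  have h := sub_rp_lp (star x)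
  rw [lp_star] at h
  exact exists_equiv_of_sub_of_sub (rp_proj x) (lp_proj x) (sub_rp_lp x) h

end RickartCStar

/-- A C*-algebra with a unit, as a unital C*-algebra. -/
noncomputable abbrev NonUnitalCStarAlgebra.toCStarAlgebraOfUnit {A : Type*}
    [inst : NonUnitalCStarAlgebra A] (u : A) (hu : ∀ a : A, u * a = a ∧ a * u = a) :
    CStarAlgebra A :=
  { inst with
    one := u
    one_mul := fun a => (hu a).1
    mul_one := fun a => (hu a).2
    toAlgebra :=
      letI : Ring A := { (inferInstance : NonUnitalRing A) with
        one := u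
        one_mul := fun a => (hu a).1
        mul_one := fun a => (hu a).2 }
      Algebra.ofModule smul_mul_assoc mul_smul_comm
    norm_smul_le := norm_smul_le }

namespace IsRickart

variable {A : Type*} [NonUnitalCStarAlgebra A]

theorem exists_unit (h : IsRickart A) : ∃ u : A, ∀ a : A, u * a = a ∧ a * u = a := by
  obtain ⟨p, hp, hker⟩ := h 0
  have hl : ∀ a : A, p * a = a := fun a => by
    obtain ⟨b, rfl⟩ : a ∈ {z : A | ∃ a : A, z = p * a} := hker ▸ zero_mul a
    rw [← mul_assoc, hp.2]
  exact ⟨p, fun a => ⟨hl a, by simpa [hp.1] using congrArg star (hl (star a))⟩⟩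

theorem exists_polar (h : IsRickart A) (x : A) : ∃ v : A, IsPartialIsometry v ∧
    v * star v * x = x ∧ x * (star v * v) = x ∧ (∀ z, x * z = 0 → star v * v * z = 0) ∧
      ∀ z, z * x = 0 → z * (v * star v) = 0 := by
  obtain ⟨u, hu⟩ := h.exists_unit
  let _ := NonUnitalCStarAlgebra.toCStarAlgebraOfUnit u hu
  have : RickartCStar A := ⟨fun x => by
    obtain ⟨p, hp, hker⟩ := h x
    refine ⟨1 - p, hp.one_sub, fun z => ?_⟩
    have : x * z = 0 ↔ ∃ a, z = p * a := Set.ext_iff.1 hker z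
    rw [this, sub_mul, one_mul, sub_eq_zero]
    exact ⟨fun ⟨a, ha⟩ => by rw [ha, ← mul_assoc, hp.2], fun h => ⟨z, h⟩⟩⟩
  obtain ⟨v, hr, hl⟩ := RickartCStar.exists_equiv_rp_lp x
  refine ⟨v, ?_, ?_, ?_, fun z => ?_, fun z => ?_⟩
  · rw [IsPartialIsometry, hl]
    exact RickartCStar.lp_proj x
  · rw [hl, RickartCStar.lp_mul]
  · rw [hr, RickartCStar.mul_rp]
  · rw [hr]
    exact (RickartCStar.rp_ker x z).1
  · rw [hl]
    exact (RickartCStar.lp_ker x z).1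

end IsRickart

section PeirceCondition

variable {A : Type*} [NonUnitalCStarAlgebra A]

theorem mul_eq_zero_of_mul_star_mul_mul {x z : A} (h : x * star x * x * z = 0) : x * z = 0 := by
  have h1 : star x * x * z = 0 := by
    rw [← CStarRing.star_mul_self_eq_zero_iff]
    simp only [star_mul, star_star, mul_assoc] at h ⊢
    rw [h, mul_zero, mul_zero]
  rw [← CStarRing.star_mul_self_eq_zero_iff, star_mul]
  simp only [mul_assoc] at h1 ⊢
  rw [h1, mul_zero]

theorem mul_eq_zero_of_mul_mul_star_mul {x z : A} (h : z * (x * star x * x) = 0) : z * x = 0 := by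
  have := mul_eq_zero_of_mul_star_mul_mul (x := star x) (z := star z)
    (by simpa [mul_assoc] using congrArg star h)
  simpa using congrArg star this

theorem IsRickart.exists_peirce (h : IsRickart A) (x : A) (J : Submodule ℂ A)
    (hJ : ∀ s ∈ innerIdealGen x, ∀ t ∈ (J : Set A), Orthog s t) :
    ∃ e : A, IsPartialIsometry e ∧ innerIdealGen x ⊆ Peirce2 e ∧ (J : Set A) ⊆ Peirce0 e := by
  obtain ⟨v, hv, hl, hr, hrk, hlk⟩ := h.exists_polar x
  refine ⟨v, hv, ?_, fun t ht => ?_⟩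
  · refine closure_minimal ?_ (isClosed_eq (by fun_prop) continuous_id)
    rintro _ ⟨a, rfl⟩
    show v * star v * (x * a * x) * (star v * v) = x * a * x
    rw [← mul_assoc (v * star v), ← mul_assoc (v * star v) x a, hl, mul_assoc, hr]
  · obtain ⟨h1, h2⟩ := hJ _ (subset_closure ⟨star x, rfl⟩) t ht
    have h3 := hrk _ (mul_eq_zero_of_mul_star_mul_mul h1)
    have h4 := hlk _ (mul_eq_zero_of_mul_mul_star_mul h2)
    exact ⟨by simpa [mul_assoc] using congrArg star h4, by simpa [mul_assoc] using congrArg star h3⟩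

/-- The elements annihilated by `h` on both sides. -/
def annihilator (h : A) : Submodule ℂ A where
  carrier := {y | h * y = 0 ∧ y * h = 0}
  add_mem' := fun ha hb => ⟨by rw [mul_add, ha.1, hb.1, add_zero],
    by rw [add_mul, ha.2, hb.2, add_zero]⟩
  zero_mem' := ⟨mul_zero h, zero_mul h⟩
  smul_mem' := fun c y hy => ⟨by rw [mul_smul_comm, hy.1, smul_zero],
    by rw [smul_mul_assoc, hy.2, smul_zero]⟩

theorem isInnerIdeal_annihilator (h : A) : IsInnerIdeal (annihilator h) :=
  fun x hx y hy a => ⟨by rw [← mul_assoc, ← mul_assoc, hx.1, zero_mul, zero_mul],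
    by rw [mul_assoc, hy.2, mul_zero]⟩

theorem orthog_annihilator {h : A} (hh : star h = h) :
    ∀ s ∈ innerIdealGen h, ∀ t ∈ (annihilator h : Set A), Orthog s t := by
  intro s hs t ht
  have h1 : h * star t = 0 := by simpa [hh] using congrArg star ht.2
  have h2 : star t * h = 0 := by simpa [hh] using congrArg star ht.1
  refine ⟨closure_minimal (t := {s | s * star t = 0}) ?_
      (isClosed_eq (by fun_prop) continuous_const) hs,
    closure_minimal (t := {s | star t * s = 0}) ?_
      (isClosed_eq (by fun_prop) continuous_const) hs⟩
  · rintro _ ⟨a, rfl⟩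
    show h * a * h * star t = 0
    rw [mul_assoc, h1, mul_zero]
  · rintro _ ⟨a, rfl⟩
    show star t * (h * a * h) = 0
    rw [← mul_assoc, ← mul_assoc, h2, zero_mul, zero_mul]

theorem isRickart_of_peirce {u : A} (hu : ∀ a : A, u * a = a ∧ a * u = a)
    (H : ∀ (x : A) (J : Submodule ℂ A), IsInnerIdeal J →
      (∀ s ∈ innerIdealGen x, ∀ t ∈ (J : Set A), Orthog s t) →
      ∃ e : A, IsPartialIsometry e ∧ innerIdealGen x ⊆ Peirce2 e ∧ (J : Set A) ⊆ Peirce0 e) :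
    IsRickart A := by
  intro x
  have hh : star (star x * x) = star x * x := by rw [star_mul, star_star]
  obtain ⟨e, hq, h2, h0⟩ := H (star x * x) (annihilator (star x * x))
    (isInnerIdeal_annihilator _) (orthog_annihilator hh)
  rw [IsPartialIsometry] at hq
  have hsq : e * star e * (star x * x * (star x * x)) = star x * x * (star x * x) := by
    have h3 : e * star e * (star x * x * u * (star x * x)) * (star e * e)
      = star x * x * u * (star x * x) := h2 (subset_closure ⟨u, rfl⟩)
    rw [(hu _).2] at h3
    rw [← h3, ← mul_assoc (e * star e), ← mul_assoc (e * star e), hq.2]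
  have hker : ∀ y, x * y = 0 → e * star e * y = 0 := fun y hy => by
    have : e * star e * (y * star y) = 0 := by
      refine (h0 (show y * star y ∈ annihilator (star x * x) from ⟨?_, ?_⟩)).1
      · rw [mul_assoc, ← mul_assoc x, hy, zero_mul, mul_zero]
      · have : star y * star x = 0 := by simpa using congrArg star hy
        rw [mul_assoc, ← mul_assoc (star y), this, zero_mul, mul_zero]
    rw [← CStarRing.mul_star_self_eq_zero_iff, star_mul, hq.1, mul_assoc, ← mul_assoc y,
      ← mul_assoc, this, zero_mul]
  generalize e * star e = q at *
  have hustar : star u = u := by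
    have := congrArg star (hu (star u)).1
    rw [star_mul, star_star, (hu _).1] at this
    exact this
  have hxq : x * (u - q) = 0 := by
    have h1 : (u - q) * (star x * x * (star x * x)) = 0 := by
      rw [sub_mul, (hu _).1, hsq, sub_self]
    have h3 : (u - q) * (star x * x) = 0 := by
      rw [← CStarRing.mul_star_self_eq_zero_iff, star_mul, hh, ← mul_assoc,
        mul_assoc (u - q), h1, zero_mul]
    have h4 : star x * x * (u - q) = 0 := by
      simpa [hustar, hq.1, mul_assoc] using congrArg star h3
    rw [← CStarRing.star_mul_self_eq_zero_iff, star_mul, mul_assoc, ← mul_assoc (star x), h4,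
      mul_zero]
  refine ⟨u - q, ⟨by rw [star_sub, hustar, hq.1], ?_⟩, Set.ext fun y => ⟨fun hy => ⟨y, ?_⟩, ?_⟩⟩
  · rw [mul_sub, sub_mul, sub_mul, (hu _).1, (hu _).1, (hu _).2, hq.2, sub_self, sub_zero]
  · rw [sub_mul, (hu _).1, hker y hy, sub_zero]
  · rintro ⟨a, rfl⟩
    show x * ((u - q) * a) = 0
    rw [← mul_assoc, hxq, zero_mul]

end PeirceCondition

/-- A C*-algebra `A` is a Rickart C*-algebra if, and only if, `A` is unital and for every
`x ∈ A` and every inner ideal `J ⊆ A` orthogonal to the inner ideal `A(x)` generated by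
`x`, there exists a partial isometry `e ∈ A` with `A(x) ⊆ A₂(e)` and `J ⊆ A₀(e)`. -/
theorem rickart_iff_unital_and_peirce_condition {A : Type*} [NonUnitalCStarAlgebra A] :
    IsRickart A ↔
      (∃ u : A, ∀ a : A, u * a = a ∧ a * u = a) ∧
      (∀ (x : A) (J : Submodule ℂ A), IsInnerIdeal J →
        (∀ s ∈ innerIdealGen x, ∀ t ∈ (J : Set A), Orthog s t) →
        ∃ e : A, IsPartialIsometry e ∧
          innerIdealGen x ⊆ Peirce2 e ∧ (J : Set A) ⊆ Peirce0 e) := by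
  exact ⟨fun h => ⟨h.exists_unit, fun x J _ => h.exists_peirce x J⟩,
    fun ⟨⟨_, hu⟩, H⟩ => isRickart_of_peirce hu H⟩
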